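/- arXiv:2403.09469 — 10 statements merged into one kernel-verified Lean document; each statement's English description precedes it below -/
import Mathlib

section
/- Let k be a field of characteristic p > 0, let n ≥ 1, and let A be a 2×2 matrix with entries in k[T]/(T^{p^n}) such that (i) the image of A under the k-algebra map k[T]/(T^{p^n}) → k sending T̄ to 0 is the identity matrix, and (ii) in M₂(k[S,T]/(S^{p^n}, T^{p^n})) one has A(S̄+T̄) = A(S̄)·A(T̄), where A(S̄+T̄), A(S̄), A(T̄) denote the images of A under the k-algebra maps sending T̄ to S̄+T̄, to S̄, and to T̄ respectively. Then there exist a matrix B ∈ M₂(k) with B² = 0 and an element f ∈ k[T]/(T^{p^n}) with f(S̄+T̄) = f(S̄) + f(T̄) in k[S,T]/(S^{p^n}, T^{p^n}) and zero constant term, such that A = Id + f·B. -/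
/-- The truncated polynomial ring `k[T]/(T^N)`. -/
abbrev TruncPoly (k : Type*) [CommRing k] (N : ℕ) : Type _ :=
  Polynomial k ⧸ Ideal.span {(Polynomial.X : Polynomial k) ^ N}

/-- The class of `T` in `k[T]/(T^N)`. -/
noncomputable abbrev truncT (k : Type*) [CommRing k] (N : ℕ) : TruncPoly k N :=
  Ideal.Quotient.mk _ Polynomial.X

/-- The truncated polynomial ring `k[S,T]/(S^M, T^N)`, with `S = X 0` and `T = X 1`. -/
abbrev TruncPoly₂ (k : Type*) [CommRing k] (M N : ℕ) : Type _ :=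
  MvPolynomial (Fin 2) k ⧸
    Ideal.span {(MvPolynomial.X 0 : MvPolynomial (Fin 2) k) ^ M, (MvPolynomial.X 1) ^ N}

/-- The class of `S` in `k[S,T]/(S^M, T^N)`. -/
noncomputable abbrev truncS₂ (k : Type*) [CommRing k] (M N : ℕ) : TruncPoly₂ k M N :=
  Ideal.Quotient.mk _ (MvPolynomial.X 0)

/-- The class of `T` in `k[S,T]/(S^M, T^N)`. -/
noncomputable abbrev truncT₂ (k : Type*) [CommRing k] (M N : ℕ) : TruncPoly₂ k M N :=
  Ideal.Quotient.mk _ (MvPolynomial.X 1)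

open Finset in
/-- Expansion of `∑ c m (x + y) ^ m` in the monomials `x ^ i * y ^ j`. -/
theorem sum_smul_add_pow_eq {k R : Type*} [CommRing k] [CommRing R] [Algebra k R] (N : ℕ)
    (c : ℕ → k) (hc : ∀ m, N ≤ m → c m = 0) (x y : R) :
    ∑ m ∈ range N, c m • (x + y) ^ m =
      ∑ i ∈ range N, ∑ j ∈ range N, (((i + j).choose i : k) * c (i + j)) • (x ^ i * y ^ j) := by
  have h : ∀ m ∈ range N, c m • (x + y) ^ m =
      ∑ q ∈ range N ×ˢ range N with q.1 + q.2 = m,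
        (((q.1 + q.2).choose q.1 : k) * c (q.1 + q.2)) • (x ^ q.1 * y ^ q.2) := by
    intro m hm
    have hs : (range N ×ˢ range N).filter (fun q => q.1 + q.2 = m) = antidiagonal m := by
      ext q
      simp only [mem_filter, mem_product, mem_range, HasAntidiagonal.mem_antidiagonal] at hm ⊢
      omega
    rw [hs, (Commute.all x y).add_pow', smul_sum]
    refine sum_congr rfl fun q hq => ?_
    rw [HasAntidiagonal.mem_antidiagonal] at hq
    rw [hq, mul_comm (_ : k), mul_smul, ← Nat.cast_smul_eq_nsmul k]
  rw [sum_congr rfl h, ← sum_product']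
  have hN : ∀ q ∈ range N ×ˢ range N, q.1 + q.2 ∉ range N →
      (((q.1 + q.2).choose q.1 : k) * c (q.1 + q.2)) • (x ^ q.1 * y ^ q.2) = 0 := by
    intro q _ hq
    rw [hc _ (by simpa using hq), mul_zero, zero_smul]
  rw [← sum_filter_of_ne (p := fun q : ℕ × ℕ => q.1 + q.2 ∈ range N)
    (fun q hq hne => by_contra fun hq' => hne (hN q hq hq'))]
  rw [← sum_fiberwise_of_maps_to (t := range N) (g := fun q : ℕ × ℕ => q.1 + q.2)
    (fun q hq => (mem_filter.mp hq).2)]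
  refine sum_congr rfl fun m hm => sum_congr ?_ fun _ _ => rfl
  ext q
  simp only [mem_filter]
  constructor
  · rintro ⟨h1, rfl⟩
    exact ⟨⟨h1, hm⟩, rfl⟩
  · rintro ⟨⟨h1, _⟩, h2⟩
    exact ⟨h1, h2⟩

theorem TruncPoly.exists_eq_sum (k : Type*) [CommRing k] (N : ℕ) (x : TruncPoly k N) :
    ∃ c : ℕ → k, (∀ m, N ≤ m → c m = 0) ∧
      x = ∑ m ∈ Finset.range N, c m • truncT k N ^ m := by
  classical
  obtain ⟨P, rfl⟩ := Ideal.Quotient.mk_surjective x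
  refine ⟨fun m => if m < N then P.coeff m else 0, fun m hm => if_neg (by omega), ?_⟩
  have h : ∑ m ∈ Finset.range N, (if m < N then P.coeff m else 0) • truncT k N ^ m =
      Ideal.Quotient.mk (Ideal.span {(Polynomial.X : Polynomial k) ^ N})
        (∑ m ∈ Finset.range N, P.coeff m • Polynomial.X ^ m) := by
    rw [map_sum]
    refine Finset.sum_congr rfl fun m hm => ?_
    rw [if_pos (Finset.mem_range.mp hm), ← map_pow]
    rfl
  rw [h, Ideal.Quotient.mk_eq_mk_iff_sub_mem, Ideal.mem_span_singleton,
    Polynomial.X_pow_dvd_iff]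
  intro d hd
  simp [Polynomial.coeff_X_pow, hd]

theorem TruncPoly₂.eq_zero_of_sum_eq_zero (k : Type*) [CommRing k] (M N : ℕ) (c : ℕ → ℕ → k)
    (h : ∑ i ∈ Finset.range M, ∑ j ∈ Finset.range N,
      c i j • (truncS₂ k M N ^ i * truncT₂ k M N ^ j) = 0)
    {i j : ℕ} (hi : i < M) (hj : j < N) : c i j = 0 := by
  classical
  let m : ℕ → ℕ → (Fin 2 →₀ ℕ) := fun i j => Finsupp.single 0 i + Finsupp.single 1 j
  have hm : ∀ i j i' j', m i j = m i' j' ↔ i = i' ∧ j = j' := by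
    intro i j i' j'
    refine ⟨fun h => ?_, by rintro ⟨rfl, rfl⟩; rfl⟩
    have h0 := DFunLike.congr_fun h 0
    have h1 := DFunLike.congr_fun h 1
    simp [m] at h0 h1
    exact ⟨h0, h1⟩
  have hs : ∑ i ∈ Finset.range M, ∑ j ∈ Finset.range N,
      c i j • (truncS₂ k M N ^ i * truncT₂ k M N ^ j) =
      Ideal.Quotient.mk (Ideal.span {(MvPolynomial.X 0 : MvPolynomial (Fin 2) k) ^ M,
        (MvPolynomial.X 1) ^ N})
        (∑ i ∈ Finset.range M, ∑ j ∈ Finset.range N, MvPolynomial.monomial (m i j) (c i j)) := by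
    simp only [map_sum]
    refine Finset.sum_congr rfl fun i _ => Finset.sum_congr rfl fun j _ => ?_
    have : MvPolynomial.monomial (m i j) (c i j) =
        c i j • ((MvPolynomial.X 0 : MvPolynomial (Fin 2) k) ^ i * MvPolynomial.X 1 ^ j) := by
      simp [m, MvPolynomial.X_pow_eq_monomial, MvPolynomial.monomial_mul,
        MvPolynomial.smul_monomial]
    rw [this, ← map_pow, ← map_pow, ← map_mul]
    rfl
  rw [hs, Ideal.Quotient.eq_zero_iff_mem, Ideal.mem_span_pair] at h
  obtain ⟨a, b, hab⟩ := h
  have hcoeff := congrArg (MvPolynomial.coeff (m i j)) hab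
  have h0 : ¬ Finsupp.single (0 : Fin 2) M ≤ m i j := fun hle => by
    have := hle 0
    simp [m] at this
    omega
  have h1 : ¬ Finsupp.single (1 : Fin 2) N ≤ m i j := fun hle => by
    have := hle 1
    simp [m] at this
    omega
  rw [MvPolynomial.coeff_add, MvPolynomial.X_pow_eq_monomial, MvPolynomial.X_pow_eq_monomial,
    MvPolynomial.coeff_mul_monomial', MvPolynomial.coeff_mul_monomial', if_neg h0, if_neg h1,
    add_zero] at hcoeff
  simp only [MvPolynomial.coeff_sum, MvPolynomial.coeff_monomial, hm] at hcoeff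
  rw [Finset.sum_eq_single i, Finset.sum_eq_single j] at hcoeff
  · simpa using hcoeff.symm
  · intro j' _ hne
    rw [if_neg (fun h => hne h.2)]
  · exact fun h => absurd (Finset.mem_range.mpr hj) h
  · intro i' _ hne
    exact Finset.sum_eq_zero fun j' _ => if_neg (fun h => hne h.1)
  · exact fun h => absurd (Finset.mem_range.mpr hi) h

theorem Matrix.fin_two_entries_of_isNilpotent {k : Type*} [CommRing k] [IsReduced k]
    {A : Matrix (Fin 2) (Fin 2) k} (hA : IsNilpotent A) :
    A 1 1 = -A 0 0 ∧ A 0 0 ^ 2 + A 0 1 * A 1 0 = 0 := by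
  have ht : A.trace = 0 := (Matrix.isNilpotent_trace_of_isNilpotent hA).eq_zero
  have hd : A.det = 0 := by
    obtain ⟨m, hm⟩ := hA
    have hm' : A.det ^ (m + 1) = 0 := by
      rw [← Matrix.det_pow, pow_succ, hm, zero_mul, Matrix.det_zero]
    exact IsNilpotent.eq_zero ⟨m + 1, hm'⟩
  rw [Matrix.trace_fin_two] at ht
  rw [Matrix.det_fin_two] at hd
  exact ⟨by linear_combination ht, by linear_combination A 0 0 * ht - hd⟩

theorem Matrix.sq_eq_zero_of_isNilpotent_fin_two {k : Type*} [CommRing k] [IsReduced k]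
    {A : Matrix (Fin 2) (Fin 2) k} (hA : IsNilpotent A) : A ^ 2 = 0 := by
  obtain ⟨h1, h2⟩ := Matrix.fin_two_entries_of_isNilpotent hA
  ext i j
  fin_cases i <;> fin_cases j <;> simp [pow_two, Matrix.mul_apply, Fin.sum_univ_two, h1]
  · linear_combination h2
  · ring
  · ring
  · linear_combination h2

/-- Two commuting nilpotent `2 × 2` matrices over a field are proportional. -/
theorem Matrix.exists_eq_smul_of_commute_of_isNilpotent {k : Type*} [Field k]
    {A B : Matrix (Fin 2) (Fin 2) k} (hA : IsNilpotent A) (hB : IsNilpotent B)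
    (hAB : A * B = B * A) (hB0 : B ≠ 0) : ∃ c : k, A = c • B := by
  obtain ⟨hA1, hA2⟩ := Matrix.fin_two_entries_of_isNilpotent hA
  obtain ⟨hB1, hB2⟩ := Matrix.fin_two_entries_of_isNilpotent hB
  have e00 := congrFun (congrFun hAB 0) 0
  have e01 := congrFun (congrFun hAB 0) 1
  have e10 := congrFun (congrFun hAB 1) 0
  simp only [Matrix.mul_apply, Fin.sum_univ_two, hA1, hB1] at e00 e01 e10
  have h1 : A 0 1 * B 1 0 = A 1 0 * B 0 1 := by linear_combination e00
  have h2 : A 0 0 * B 0 1 = A 0 1 * B 0 0 := by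
    refine sub_eq_zero.mp (pow_eq_zero_iff two_ne_zero |>.mp ?_)
    linear_combination A 0 0 * B 0 1 * e01 + A 0 1 ^ 2 * hB2 - B 0 1 ^ 2 * hA2
      - A 0 1 * B 0 1 * h1
  have h3 : A 0 0 * B 1 0 = A 1 0 * B 0 0 := by
    refine sub_eq_zero.mp (pow_eq_zero_iff two_ne_zero |>.mp ?_)
    linear_combination -A 0 0 * B 1 0 * e10 + A 1 0 ^ 2 * hB2 - B 1 0 ^ 2 * hA2
      + A 1 0 * B 1 0 * h1
  by_cases hy : B 0 1 = 0
  · by_cases hz : B 1 0 = 0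
    · have hx : B 0 0 = 0 := by
        refine pow_eq_zero_iff two_ne_zero |>.mp ?_
        linear_combination hB2 - B 1 0 * hy
      refine absurd ?_ hB0
      ext i j
      fin_cases i <;> fin_cases j <;> simp [hx, hy, hz, hB1]
    · refine ⟨A 1 0 / B 1 0, ?_⟩
      ext i j
      fin_cases i <;> fin_cases j <;> simp [hA1, hB1] <;> field_simp
      · linear_combination h3
      · linear_combination h1
      · linear_combination h3
  · refine ⟨A 0 1 / B 0 1, ?_⟩
    ext i j
    fin_cases i <;> fin_cases j <;> simp [hA1, hB1] <;> field_simp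
    · linear_combination h2
    · linear_combination -h1
    · linear_combination h2

/-- A finitely supported sequence of divided powers in `M₂(k)` consists, in positive degrees, of
multiples of a single square-zero matrix. -/
theorem Matrix.exists_eq_smul_of_mul_eq_choose_smul {k : Type*} [Field k] (N : ℕ)
    (a : ℕ → Matrix (Fin 2) (Fin 2) k) (ha : ∀ m, N ≤ m → a m = 0)
    (hmul : ∀ i j, a i * a j = ((i + j).choose i : k) • a (i + j)) :
    ∃ (B : Matrix (Fin 2) (Fin 2) k) (c : ℕ → k), B ^ 2 = 0 ∧ c 0 = 0 ∧
      (∀ m, 1 ≤ m → a m = c m • B) ∧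
      ∀ i j, 1 ≤ i → 1 ≤ j → ((i + j).choose i : k) * c (i + j) = 0 := by
  have hpow : ∀ i m, ∃ d : k, a i ^ (m + 1) = d • a (i * (m + 1)) := by
    intro i m
    induction m with
    | zero => exact ⟨1, by simp⟩
    | succ m ih =>
      obtain ⟨d, hd⟩ := ih
      exact ⟨_, by rw [pow_succ, hd, smul_mul_assoc, hmul, smul_smul, ← Nat.mul_succ]⟩
  have hnil : ∀ i, 1 ≤ i → IsNilpotent (a i) := by
    intro i hi
    obtain ⟨d, hd⟩ := hpow i N
    exact ⟨N + 1, by rw [hd, ha _ (by nlinarith), smul_zero]⟩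
  have hcomm : ∀ i j, a i * a j = a j * a i := by
    intro i j
    rw [hmul, hmul, add_comm j i, Nat.choose_symm_add]
  by_cases hz : ∀ i, 1 ≤ i → a i = 0
  · exact ⟨0, fun _ => 0, by simp, rfl, fun m hm => by simp [hz m hm], by simp⟩
  push Not at hz
  obtain ⟨i₀, hi₀, hB0⟩ := hz
  have hB2 := Matrix.sq_eq_zero_of_isNilpotent_fin_two (hnil i₀ hi₀)
  have hex : ∀ i, ∃ c : k, 1 ≤ i → a i = c • a i₀ := by
    intro i
    by_cases hi : 1 ≤ i
    · obtain ⟨c, hc⟩ := Matrix.exists_eq_smul_of_commute_of_isNilpotent (hnil i hi) (hnil i₀ hi₀)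
        (hcomm i i₀) hB0
      exact ⟨c, fun _ => hc⟩
    · exact ⟨0, fun h => absurd h hi⟩
  choose c hc using hex
  have hzero : ∀ i, 1 ≤ i → ∀ d : k, d • a i = 0 → d * c i = 0 := by
    intro i hi d hd
    rw [hc i hi, smul_smul] at hd
    exact (smul_eq_zero.mp hd).resolve_right hB0
  refine ⟨a i₀, fun m => if m = 0 then 0 else c m, hB2, if_pos rfl,
    fun m hm => ?_, fun i j hi hj => ?_⟩
  · rw [hc m hm]
    simp [show m ≠ 0 by omega]
  · have h := hzero (i + j) (by omega) ((i + j).choose i : k)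
      (by rw [← hmul, hc i hi, hc j hj, smul_mul_smul_comm, ← pow_two, hB2, smul_zero])
    have hij : i + j ≠ 0 := by omega
    simpa only [if_neg hij] using h

theorem TruncPoly.algHom_sum {k R : Type*} [CommRing k] [CommRing R] [Algebra k R] {N : ℕ}
    (g : TruncPoly k N →ₐ[k] R) (c : ℕ → k) :
    g (∑ m ∈ Finset.range N, c m • truncT k N ^ m) =
      ∑ m ∈ Finset.range N, c m • g (truncT k N) ^ m := by
  simp only [map_sum, map_smul, map_pow]

theorem TruncPoly.algHom_sum_of_eq_zero {k : Type*} [CommRing k] {N : ℕ}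
    (ε : TruncPoly k N →ₐ[k] k) (hN : 0 < N) (hε : ε (truncT k N) = 0) (c : ℕ → k) :
    ε (∑ m ∈ Finset.range N, c m • truncT k N ^ m) = c 0 := by
  rw [TruncPoly.algHom_sum, hε, Finset.sum_eq_single 0]
  · simp
  · intro m _ hm
    rw [zero_pow hm, smul_zero]
  · exact fun h => absurd (Finset.mem_range.mpr hN) h

/-- A `2 × 2` matrix over `k[T]/(T^N)` with `M(0) = 1` and `M(S + T) = M(S) * M(T)` has the form
`1 + f • B` with `B` square-zero over `k` and `f` additive. -/
theorem TruncPoly.exists_eq_one_add_smul {k : Type*} [Field k] {N : ℕ} (hNpos : 0 < N)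
    (M : Matrix (Fin 2) (Fin 2) (TruncPoly k N))
    (ε : TruncPoly k N →ₐ[k] k)
    (σ τ στ : TruncPoly k N →ₐ[k] TruncPoly₂ k N N)
    (hε : ε (truncT k N) = 0)
    (hσ : σ (truncT k N) = truncS₂ k N N)
    (hτ : τ (truncT k N) = truncT₂ k N N)
    (hστ : στ (truncT k N) = truncS₂ k N N + truncT₂ k N N)
    (hM0 : M.map ε = 1)
    (hMhom : M.map στ = M.map σ * M.map τ) :
    ∃ (B : Matrix (Fin 2) (Fin 2) k) (f : TruncPoly k N),
      B ^ 2 = 0 ∧ στ f = σ f + τ f ∧ ε f = 0 ∧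
      M = 1 + f • B.map (algebraMap k (TruncPoly k N)) := by
  choose c hc hMc using fun r s => TruncPoly.exists_eq_sum k N (M r s)
  let a : ℕ → Matrix (Fin 2) (Fin 2) k := fun m => Matrix.of fun r s => c r s m
  have ha : ∀ m, N ≤ m → a m = 0 := by
    intro m hm
    ext r s
    exact hc r s m hm
  have ha0 : a 0 = 1 := by
    rw [← hM0]
    ext r s
    rw [Matrix.map_apply, hMc r s, TruncPoly.algHom_sum_of_eq_zero ε hNpos hε]
    rfl
  have hmul : ∀ i j, a i * a j = ((i + j).choose i : k) • a (i + j) := by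
    intro i j
    by_cases hi : N ≤ i
    · rw [ha i hi, ha (i + j) (by omega), zero_mul, smul_zero]
    by_cases hj : N ≤ j
    · rw [ha j hj, ha (i + j) (by omega), mul_zero, smul_zero]
    ext r s
    have h := congrFun (congrFun hMhom r) s
    simp only [Matrix.mul_apply, Matrix.map_apply] at h
    rw [hMc r s, TruncPoly.algHom_sum, hστ, sum_smul_add_pow_eq N (c r s) (hc r s)] at h
    have h' : ∀ t, σ (M r t) * τ (M t s) = ∑ i ∈ Finset.range N, ∑ j ∈ Finset.range N,
        (c r t i * c t s j) • (truncS₂ k N N ^ i * truncT₂ k N N ^ j) := by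
      intro t
      rw [hMc r t, hMc t s, TruncPoly.algHom_sum, TruncPoly.algHom_sum, hσ, hτ, Finset.sum_mul_sum]
      simp only [smul_mul_smul_comm]
    rw [Fin.sum_univ_two, h', h', ← sub_eq_zero] at h
    simp only [← Finset.sum_add_distrib, ← Finset.sum_sub_distrib, ← add_smul, ← sub_smul] at h
    have h0 := TruncPoly₂.eq_zero_of_sum_eq_zero k N N _ h (not_le.mp hi) (not_le.mp hj)
    rw [Matrix.mul_apply, Matrix.smul_apply, smul_eq_mul, Fin.sum_univ_two]
    exact (sub_eq_zero.mp h0).symm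
  obtain ⟨B, d, hB, hd0, had, hadd⟩ :=
    Matrix.exists_eq_smul_of_mul_eq_choose_smul N a ha hmul
  refine ⟨B, ∑ m ∈ Finset.range N, d m • truncT k N ^ m, hB, ?_, ?_, ?_⟩
  · simp only [TruncPoly.algHom_sum]
    rw [hστ, hσ, hτ, ← Finset.sum_add_distrib]
    refine Finset.sum_congr rfl fun m _ => ?_
    rw [← smul_add]
    rcases m with _ | m
    · rw [hd0, zero_smul, zero_smul]
    rw [add_pow, Finset.sum_range_succ, Finset.sum_range_succ', add_assoc, smul_add,
      Finset.smul_sum, Finset.sum_eq_zero, zero_add]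
    · simp [add_comm]
    · intro i hi
      rw [Finset.mem_range] at hi
      obtain ⟨j, rfl⟩ : ∃ j, m = i + j + 1 := ⟨m - i - 1, by omega⟩
      have := hadd (i + 1) (j + 1) (by omega) (by omega)
      rw [show i + 1 + (j + 1) = i + j + 1 + 1 by ring] at this
      rw [← nsmul_eq_mul', ← Nat.cast_smul_eq_nsmul k, smul_smul, mul_comm, this, zero_smul]
  · rw [TruncPoly.algHom_sum_of_eq_zero ε hNpos hε, hd0]
  · ext r s
    obtain ⟨N', rfl⟩ : ∃ N', N = N' + 1 := ⟨N - 1, by omega⟩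
    have hc0 : c r s 0 = (1 : Matrix (Fin 2) (Fin 2) k) r s := congrFun (congrFun ha0 r) s
    have hcm : ∀ m, c r s (m + 1) = d (m + 1) * B r s := fun m =>
      congrFun (congrFun (had (m + 1) (by omega)) r) s
    rw [Matrix.add_apply, Matrix.smul_apply, Matrix.map_apply, hMc r s, smul_eq_mul, mul_comm,
      ← Algebra.smul_def, Finset.sum_range_succ', Finset.sum_range_succ', hd0, zero_smul, add_zero,
      hc0, Finset.smul_sum, add_comm ((1 : Matrix (Fin 2) (Fin 2) _) r s)]
    refine congrArg₂ (· + ·) ?_ ?_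
    · refine Finset.sum_congr rfl fun m _ => ?_
      rw [hcm, smul_smul, mul_comm]
    · rw [Matrix.one_apply, Matrix.one_apply]
      split_ifs <;> simp

/-- Let `k` be a field of characteristic `p > 0`, `n ≥ 1`, and let `M` be a `2 × 2` matrix over
`k[T]/(T^{p^n})` whose image under the `k`-algebra map `ε` sending `T̄` to `0` is the identity
and which satisfies `M(S̄+T̄) = M(S̄) * M(T̄)` in `M₂(k[S,T]/(S^{p^n}, T^{p^n}))`, where the
evaluations are the `k`-algebra maps `στ, σ, τ` sending `T̄` to `S̄+T̄`, `S̄`, `T̄`.  Then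
`M = 1 + f • B` for some matrix `B ∈ M₂(k)` with `B² = 0` and some additive `f ∈ k[T]/(T^{p^n})`
with zero constant term. -/
theorem stmt_0 (k : Type*) [Field k] (p n : ℕ) (hp : p.Prime) (hchar : CharP k p) (hn : 1 ≤ n)
    (M : Matrix (Fin 2) (Fin 2) (TruncPoly k (p ^ n)))
    (ε : TruncPoly k (p ^ n) →ₐ[k] k)
    (σ τ στ : TruncPoly k (p ^ n) →ₐ[k] TruncPoly₂ k (p ^ n) (p ^ n))
    (hε : ε (truncT k (p ^ n)) = 0)
    (hσ : σ (truncT k (p ^ n)) = truncS₂ k (p ^ n) (p ^ n))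
    (hτ : τ (truncT k (p ^ n)) = truncT₂ k (p ^ n) (p ^ n))
    (hστ : στ (truncT k (p ^ n)) = truncS₂ k (p ^ n) (p ^ n) + truncT₂ k (p ^ n) (p ^ n))
    (hM0 : M.map ε = 1)
    (hMhom : M.map στ = M.map σ * M.map τ) :
    ∃ (B : Matrix (Fin 2) (Fin 2) k) (f : TruncPoly k (p ^ n)),
      B ^ 2 = 0 ∧ στ f = σ f + τ f ∧ ε f = 0 ∧
      M = 1 + f • B.map (algebraMap k (TruncPoly k (p ^ n))) := by
  exact TruncPoly.exists_eq_one_add_smul (pow_pos hp.pos n) M ε σ τ στ hε hσ hτ hστ hM0 hMhom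
end

section
/- Let p be a prime, let R be an associative (not necessarily commutative) ring of characteristic p, and let A : ℕ → R be a family of elements with A(0) = 1 such that binom(i+j, j) • A(i+j) = A(i) · A(j) for all i, j ≥ 0 (with the binomial coefficient acting by natural-number scalar multiplication). Then A(i) · A(j) = A(j) · A(i) for all i, j, and A(i)^p = 0 for every i ≥ 1. -/
theorem Nat.dvd_choose_mul_self (m : ℕ) {i : ℕ} (hi : 1 ≤ i) : m ∣ (i * m).choose i := by
  rcases Nat.eq_zero_or_pos m with rfl | hm
  · rw [Nat.mul_zero, Nat.choose_eq_zero_of_lt hi]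
  · obtain ⟨k, rfl⟩ := Nat.exists_eq_add_of_le' hi
    obtain ⟨n, hn⟩ : ∃ n, (k + 1) * m = n + 1 :=
      Nat.exists_eq_add_of_le' (Nat.mul_pos hi hm)
    refine ⟨n.choose k, Nat.eq_of_mul_eq_mul_right hi ?_⟩
    rw [hn, ← Nat.add_one_mul_choose_eq, ← hn]
    ring

theorem exists_pow_eq_nsmul_of_choose_nsmul_eq_mul {R : Type*} [Semiring R] {A : ℕ → R}
    (h0 : A 0 = 1) (hmul : ∀ i j : ℕ, (i + j).choose j • A (i + j) = A i * A j) (i m : ℕ) :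
    ∃ c : ℕ, A i ^ m = c • A (i * m) := by
  induction m with
  | zero => exact ⟨1, by simp [h0]⟩
  | succ m ih =>
    obtain ⟨c, hc⟩ := ih
    exact ⟨c * (i * m + i).choose i,
      by rw [pow_succ, hc, smul_mul_assoc, ← hmul, mul_smul, Nat.mul_succ]⟩

/-- If `R` is a ring of prime characteristic `p` and `A : ℕ → R` satisfies `A 0 = 1` and
`(i+j).choose j • A (i+j) = A i * A j` for all `i j`, then the `A i` pairwise commute and
`A i ^ p = 0` for all `i ≥ 1`. -/
theorem stmt_2 (p : ℕ) (hp : p.Prime) (R : Type*) [Ring R] (hchar : CharP R p)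
    (A : ℕ → R) (h0 : A 0 = 1)
    (hmul : ∀ i j : ℕ, (i + j).choose j • A (i + j) = A i * A j) :
    (∀ i j : ℕ, A i * A j = A j * A i) ∧ (∀ i : ℕ, 1 ≤ i → A i ^ p = 0) := by
  refine ⟨fun i j => ?_, fun i hi => ?_⟩
  · rw [← hmul i j, ← hmul j i, Nat.add_comm j i, Nat.choose_symm_add]
  · obtain ⟨m, rfl⟩ := Nat.exists_eq_add_of_le' hp.one_le
    obtain ⟨c, hc⟩ := exists_pow_eq_nsmul_of_choose_nsmul_eq_mul h0 hmul i m
    have hdvd : ((i * m + i).choose i : R) = 0 :=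
      (CharP.cast_eq_zero_iff R (m + 1) _).2 (Nat.dvd_choose_mul_self (m + 1) hi)
    rw [pow_succ, hc, smul_mul_assoc, ← hmul, nsmul_eq_mul ((i * m + i).choose i), hdvd,
      zero_mul, smul_zero]
end

section
/- Let k be a field of characteristic p > 0 and n ≥ 1, and let f ∈ k[T]/(T^{p^n}). Then f satisfies f(S̄+T̄) = f(S̄) + f(T̄) in k[S,T]/(S^{p^n}, T^{p^n}) (where f(S̄+T̄), f(S̄), f(T̄) denote the images of f under the k-algebra maps sending T̄ to S̄+T̄, S̄, T̄ respectively) if and only if f is a k-linear combination of the elements T̄^{p^i} for 0 ≤ i ≤ n−1. -/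
open MvPolynomial in
/-- Elements of the ideal `(S^M, T^N)` have no coefficient at `S^i T^j` for `i < M`, `j < N`. -/
theorem coeff_eq_zero_of_mem_span_X_pow {k : Type*} [CommRing k] {M N : ℕ}
    {x : MvPolynomial (Fin 2) k}
    (hx : x ∈ Ideal.span {(X 0 : MvPolynomial (Fin 2) k) ^ M, (X 1) ^ N})
    {d : Fin 2 →₀ ℕ} (h0 : d 0 < M) (h1 : d 1 < N) : coeff d x = 0 := by
  obtain ⟨a, b, rfl⟩ := Ideal.mem_span_pair.mp hx
  have h0' : ¬ Finsupp.single 0 M ≤ d := by simpa using h0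
  have h1' : ¬ Finsupp.single 1 N ≤ d := by simpa using h1
  rw [coeff_add, X_pow_eq_monomial, X_pow_eq_monomial, coeff_mul_monomial', coeff_mul_monomial',
    if_neg h0', if_neg h1', add_zero]

open MvPolynomial in
/-- The coefficients of `q(S + T)`. -/
theorem coeff_aeval_X_add_X {k : Type*} [CommRing k] (q : Polynomial k) (d : Fin 2 →₀ ℕ) :
    coeff d (Polynomial.aeval (X 0 + X 1 : MvPolynomial (Fin 2) k) q) =
      q.coeff (d 0 + d 1) * ((d 0 + d 1).choose (d 0) : ℕ) := by
  induction q using Polynomial.induction_on' with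
  | add p q hp hq => simp [hp, hq, add_mul]
  | monomial n a =>
    rw [Polynomial.aeval_monomial, algebraMap_eq, coeff_C_mul, coeff_add_pow,
      Polynomial.coeff_monomial]
    by_cases h : d 0 + d 1 = n
    · simp [h]
    · simp [h, Ne.symm h]

open MvPolynomial in
/-- A univariate polynomial evaluated at one variable involves no other variable. -/
theorem coeff_aeval_X_eq_zero {σ k : Type*} [CommRing k] (q : Polynomial k) {i j : σ}
    (hij : i ≠ j) {d : σ →₀ ℕ} (hd : d j ≠ 0) :
    coeff d (Polynomial.aeval (X i : MvPolynomial σ k) q) = 0 := by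
  classical
  induction q using Polynomial.induction_on' with
  | add p q hp hq => simp [hp, hq]
  | monomial n a =>
    rw [Polynomial.aeval_monomial, algebraMap_eq, coeff_C_mul, coeff_X_pow, if_neg, mul_zero]
    rintro rfl
    exact hd (Finsupp.single_eq_of_ne hij.symm)

/-- An algebra map out of `k[T]/(T^N)` is evaluation at the image of `T`. -/
theorem TruncPoly.algHom_mk {k A : Type*} [CommRing k] [CommRing A] [Algebra k A] {N : ℕ}
    (I : Ideal A) (φ : TruncPoly k N →ₐ[k] A ⧸ I) {y : A}
    (hφ : φ (truncT k N) = Ideal.Quotient.mk I y) (q : Polynomial k) :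
    φ (Ideal.Quotient.mk _ q) = Ideal.Quotient.mk I (Polynomial.aeval y q) := by
  have : φ.comp (Ideal.Quotient.mkₐ k _) = (Ideal.Quotient.mkₐ k I).comp (Polynomial.aeval y) := by
    apply Polynomial.algHom_ext
    simpa using hφ
  exact DFunLike.congr_fun this q

open MvPolynomial in
/-- If `q` is additive modulo `(S^N, T^N)`, its coefficients in degrees below `N` are supported
on powers of `p`. -/
theorem exists_eq_pow_of_coeff_ne_zero {k : Type*} [Field k] {p N : ℕ} [Fact p.Prime] [CharP k p]
    {q : Polynomial k}
    (hq : Polynomial.aeval (X 0 + X 1 : MvPolynomial (Fin 2) k) q -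
        (Polynomial.aeval (X 0) q + Polynomial.aeval (X 1) q) ∈
      Ideal.span {(X 0 : MvPolynomial (Fin 2) k) ^ N, (X 1) ^ N})
    {m : ℕ} (hm : m < N) (hc : q.coeff m ≠ 0) : ∃ e, m = p ^ e := by
  have key (d : Fin 2 →₀ ℕ) (h0 : d 0 < N) (h1 : d 1 < N) :=
    coeff_eq_zero_of_mem_span_X_pow hq h0 h1
  simp only [coeff_sub, coeff_add, coeff_aeval_X_add_X] at key
  have hpos : 0 < m := by
    rw [Nat.pos_iff_ne_zero]
    rintro rfl
    have h := key 0 hm hm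
    have hX (i : Fin 2) :
        coeff 0 (Polynomial.aeval (X i : MvPolynomial (Fin 2) k) q) = q.coeff 0 := by
      rw [← constantCoeff_eq, Polynomial.aeval_def, Polynomial.hom_eval₂, constantCoeff_X,
        Polynomial.eval₂_at_zero]
      simp
    rw [hX, hX] at h
    apply hc
    simpa using h
  refine ⟨_, Choose.eq_pow_multiplicity_of_choose_modEq_zero_nat (p := p) hpos fun i hi => ?_⟩
  rw [Finset.mem_Icc] at hi
  have h := key (Finsupp.single 0 i + Finsupp.single 1 (m - i)) (by simp; lia) (by simp; lia)
  rw [coeff_aeval_X_eq_zero q (j := 1) (by decide) (by simp; lia),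
    coeff_aeval_X_eq_zero q (j := 0) (by decide) (by simp; lia)] at h
  have him : i + (m - i) = m := by lia
  simp only [Finsupp.add_apply, Finsupp.single_apply] at h
  norm_num [him, hc] at h
  exact (Nat.modEq_zero_iff_dvd).mpr ((CharP.cast_eq_zero_iff k p _).mp h)

/-- An element `f ∈ k[T]/(T^{p^n})` is additive, i.e. `f(S̄+T̄) = f(S̄) + f(T̄)` in
`k[S,T]/(S^{p^n}, T^{p^n})` (where `στ, σ, τ` are the `k`-algebra maps sending `T̄` to
`S̄+T̄`, `S̄`, `T̄` respectively), if and only if `f` is a `k`-linear combination of the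
elements `T̄^{p^i}` for `0 ≤ i ≤ n-1`. -/
theorem stmt_5 (k : Type*) [Field k] (p n : ℕ) (hp : p.Prime) (hchar : CharP k p) (hn : 1 ≤ n)
    (f : TruncPoly k (p ^ n))
    (σ τ στ : TruncPoly k (p ^ n) →ₐ[k] TruncPoly₂ k (p ^ n) (p ^ n))
    (hσ : σ (truncT k (p ^ n)) = truncS₂ k (p ^ n) (p ^ n))
    (hτ : τ (truncT k (p ^ n)) = truncT₂ k (p ^ n) (p ^ n))
    (hστ : στ (truncT k (p ^ n)) = truncS₂ k (p ^ n) (p ^ n) + truncT₂ k (p ^ n) (p ^ n)) :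
    στ f = σ f + τ f ↔
      ∃ a : Fin n → k, f = ∑ i : Fin n, a i • truncT k (p ^ n) ^ p ^ (i : ℕ) := by
  have := Fact.mk hp
  constructor
  · intro hf
    obtain ⟨q, rfl⟩ := Ideal.Quotient.mk_surjective f
    rw [TruncPoly.algHom_mk _ σ hσ, TruncPoly.algHom_mk _ τ hτ,
      TruncPoly.algHom_mk _ στ (y := MvPolynomial.X 0 + MvPolynomial.X 1) (by simpa using hστ),
      ← map_add, Ideal.Quotient.eq] at hf
    refine ⟨fun i => q.coeff (p ^ (i : ℕ)), ?_⟩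
    have hsum : ∑ i : Fin n, q.coeff (p ^ (i : ℕ)) • truncT k (p ^ n) ^ p ^ (i : ℕ) =
        Ideal.Quotient.mk _ (∑ i : Fin n, q.coeff (p ^ (i : ℕ)) •
          (Polynomial.X : Polynomial k) ^ p ^ (i : ℕ)) := by
      rw [map_sum]
      rfl
    rw [hsum, Ideal.Quotient.eq, Ideal.mem_span_singleton, Polynomial.X_pow_dvd_iff]
    intro m hm
    simp only [Polynomial.coeff_sub, Polynomial.finsetSum_coeff, Polynomial.coeff_smul,
      Polynomial.coeff_X_pow, smul_eq_mul, mul_ite, mul_one, mul_zero]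
    rw [sub_eq_zero]
    by_cases hc : q.coeff m = 0
    · rw [hc, Finset.sum_eq_zero]
      intro i _
      split_ifs with h
      · rw [← h, hc]
      · rfl
    · obtain ⟨e, rfl⟩ := exists_eq_pow_of_coeff_ne_zero (p := p) hf hm hc
      have he : e < n := (Nat.pow_lt_pow_iff_right hp.one_lt).mp hm
      rw [Finset.sum_eq_single ⟨e, he⟩]
      · simp
      · intro i _ hi
        rw [if_neg]
        exact fun h => hi (Fin.ext (Nat.pow_right_injective hp.two_le h).symm)
      · simp
  · rintro ⟨a, rfl⟩
    simp only [map_sum, map_smul, map_pow, hσ, hτ, hστ, ← Finset.sum_add_distrib, ← smul_add]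
    refine Finset.sum_congr rfl fun i _ => ?_
    simp only [truncS₂, truncT₂, ← map_pow, ← map_add, add_pow_char_pow]
end

section
/- Let k be a field of characteristic p > 0, let n ≥ 1 and a ∈ k. There exists a Hopf algebra structure over k on the truncated polynomial ring k[T]/(T^{p^n}) whose comultiplication Δ is the (unique) k-algebra homomorphism k[T]/(T^{p^n}) → k[T]/(T^{p^n}) ⊗_k k[T]/(T^{p^n}) satisfying Δ(T̄) = T̄⊗1 + 1⊗T̄ + a·T̄^{p^{n−1}}⊗T̄^{p}, and whose counit sends T̄ to 0. (In particular Δ is well defined, coassociative, counital, and admits an antipode.) -/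
open scoped TensorProduct

/-- `(Δ, ε, S)` is a Hopf algebra structure on the `k`-algebra `A`: the comultiplication `Δ`
and counit `ε` are `k`-algebra homomorphisms, `Δ` is coassociative, `ε` is a counit for `Δ`,
and `S` is an antipode. -/
def IsHopfAlgebraStructure (k A : Type*) [CommRing k] [CommRing A] [Algebra k A]
    (Δ : A →ₐ[k] A ⊗[k] A) (ε : A →ₐ[k] k) (S : A →ₗ[k] A) : Prop :=
  (∀ x : A, (TensorProduct.assoc k A A A)
      ((TensorProduct.map Δ.toLinearMap (LinearMap.id : A →ₗ[k] A)) (Δ x))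
      = (TensorProduct.map (LinearMap.id : A →ₗ[k] A) Δ.toLinearMap) (Δ x)) ∧
  (∀ x : A, (TensorProduct.lid k A)
      ((TensorProduct.map ε.toLinearMap (LinearMap.id : A →ₗ[k] A)) (Δ x)) = x) ∧
  (∀ x : A, (TensorProduct.rid k A)
      ((TensorProduct.map (LinearMap.id : A →ₗ[k] A) ε.toLinearMap) (Δ x)) = x) ∧
  (∀ x : A, (LinearMap.mul' k A)
      ((TensorProduct.map S (LinearMap.id : A →ₗ[k] A)) (Δ x)) = algebraMap k A (ε x)) ∧
  (∀ x : A, (LinearMap.mul' k A)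
      ((TensorProduct.map (LinearMap.id : A →ₗ[k] A) S) (Δ x)) = algebraMap k A (ε x))

/-- A triple of algebra homomorphisms satisfying the Hopf algebra axioms at a generator of a
commutative algebra is a Hopf algebra structure. -/
theorem isHopfAlgebraStructure_of_adjoin_eq_top {k A : Type*} [CommRing k] [CommRing A]
    [Algebra k A] {t : A} (ht : Algebra.adjoin k {t} = ⊤)
    {Δ : A →ₐ[k] A ⊗[k] A} {ε : A →ₐ[k] k} {S : A →ₐ[k] A}
    (hassoc : Algebra.TensorProduct.assoc k k k A A A
      (Algebra.TensorProduct.map Δ (AlgHom.id k A) (Δ t)) =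
        Algebra.TensorProduct.map (AlgHom.id k A) Δ (Δ t))
    (hleft : Algebra.TensorProduct.lid k A
      (Algebra.TensorProduct.map ε (AlgHom.id k A) (Δ t)) = t)
    (hright : Algebra.TensorProduct.rid k k A
      (Algebra.TensorProduct.map (AlgHom.id k A) ε (Δ t)) = t)
    (hantipode_left : Algebra.TensorProduct.lmul' k
      (Algebra.TensorProduct.map S (AlgHom.id k A) (Δ t)) = algebraMap k A (ε t))
    (hantipode_right : Algebra.TensorProduct.lmul' k
      (Algebra.TensorProduct.map (AlgHom.id k A) S (Δ t)) = algebraMap k A (ε t)) :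
    IsHopfAlgebraStructure k A Δ ε S.toLinearMap := by
  have ext {f g : A →ₐ[k] A} (h : f t = g t) (x : A) : f x = g x :=
    DFunLike.congr_fun (AlgHom.ext_of_adjoin_eq_top ht (by simpa [Set.EqOn] using h)) x
  refine ⟨fun x => ?_, fun x => ?_, fun x => ?_, fun x => ?_, fun x => ?_⟩
  · exact DFunLike.congr_fun (AlgHom.ext_of_adjoin_eq_top ht
      (φ₁ := ((Algebra.TensorProduct.assoc k k k A A A).toAlgHom.comp
        (Algebra.TensorProduct.map Δ (AlgHom.id k A))).comp Δ)
      (φ₂ := (Algebra.TensorProduct.map (AlgHom.id k A) Δ).comp Δ)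
      (by simpa [Set.EqOn] using hassoc)) x
  · exact ext (f := ((Algebra.TensorProduct.lid k A).toAlgHom.comp
      (Algebra.TensorProduct.map ε (AlgHom.id k A))).comp Δ) (g := AlgHom.id k A) hleft x
  · exact ext (f := ((Algebra.TensorProduct.rid k k A).toAlgHom.comp
      (Algebra.TensorProduct.map (AlgHom.id k A) ε)).comp Δ) (g := AlgHom.id k A) hright x
  · exact ext (f := ((Algebra.TensorProduct.lmul' k).comp
      (Algebra.TensorProduct.map S (AlgHom.id k A))).comp Δ)
      (g := (Algebra.ofId k A).comp ε) hantipode_left x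
  · exact ext (f := ((Algebra.TensorProduct.lmul' k).comp
      (Algebra.TensorProduct.map (AlgHom.id k A) S)).comp Δ)
      (g := (Algebra.ofId k A).comp ε) hantipode_right x

/-- In characteristic `p`, the element `t ⊗ 1 + 1 ⊗ t + a • u ⊗ v` has primitive `p ^ j`-th power
as soon as that power kills `u` or `v`. -/
theorem twistedSum_pow_char_pow {k A : Type*} [CommRing k] [CommRing A] [Algebra k A]
    (p : ℕ) [ExpChar (A ⊗[k] A) p] (a : k) (t u v : A) (j : ℕ)
    (h : u ^ p ^ j = 0 ∨ v ^ p ^ j = 0) :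
    (t ⊗ₜ[k] (1 : A) + (1 : A) ⊗ₜ[k] t + a • (u ⊗ₜ[k] v)) ^ p ^ j =
      (t ^ p ^ j) ⊗ₜ[k] (1 : A) + (1 : A) ⊗ₜ[k] (t ^ p ^ j) := by
  rw [add_pow_expChar_pow, add_pow_expChar_pow, smul_pow]
  rcases h with h | h <;> simp [Algebra.TensorProduct.tmul_pow, h]

/-- The algebra homomorphism out of `k[T]/(T^N)` with prescribed value on the class of `T`. -/
noncomputable def truncLift {k B : Type*} [CommRing k] [CommRing B] [Algebra k B] {N : ℕ}
    (b : B) (hb : b ^ N = 0) : TruncPoly k N →ₐ[k] B :=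
  Ideal.Quotient.liftₐ _ (Polynomial.aeval b) fun f hf => by
    obtain ⟨g, rfl⟩ := Ideal.mem_span_singleton.mp hf
    simp [hb]

theorem truncLift_truncT {k B : Type*} [CommRing k] [CommRing B] [Algebra k B] {N : ℕ}
    (b : B) (hb : b ^ N = 0) : truncLift (k := k) b hb (truncT k N) = b :=
  Polynomial.aeval_X b

theorem truncT_pow_self (k : Type*) [CommRing k] (N : ℕ) : truncT k N ^ N = 0 := by
  rw [← map_pow, Ideal.Quotient.eq_zero_iff_mem]
  exact Ideal.mem_span_singleton_self _

theorem adjoin_truncT (k : Type*) [CommRing k] (N : ℕ) : Algebra.adjoin k {truncT k N} = ⊤ := by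
  have h := AlgHom.map_adjoin_singleton (R := k)
    (Ideal.Quotient.mkₐ k (Ideal.span {(Polynomial.X : Polynomial k) ^ N})) Polynomial.X
  rw [Polynomial.adjoin_X, Algebra.map_top,
    (AlgHom.range_eq_top _).mpr (Ideal.Quotient.mkₐ_surjective k _)] at h
  exact h.symm

theorem nontrivial_truncPoly (k : Type*) [Field k] {N : ℕ} (hN : N ≠ 0) :
    Nontrivial (TruncPoly k N) := by
  refine Ideal.Quotient.nontrivial_iff.mpr ?_
  rw [Ne, Ideal.span_singleton_eq_top, isUnit_pow_iff hN]
  exact Polynomial.not_isUnit_X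

/-- The Hopf algebra structure given by `Δ t = t ⊗ 1 + 1 ⊗ t + a • t ^ p ^ m ⊗ t ^ p`, with
antipode `t ↦ -t + a • t ^ (p ^ m + p)`, when `t` generates and `t ^ p ^ (m + 1) = 0`. -/
theorem isHopfAlgebraStructure_of_twistedSum {k A : Type*} [CommRing k] [CommRing A]
    [Algebra k A] {p m : ℕ} (hp : p.Prime) [ExpChar A p] [ExpChar (A ⊗[k] A) p] (a : k)
    {t : A} (ht : Algebra.adjoin k {t} = ⊤) (ht0 : t ^ p ^ (m + 1) = 0)
    {Δ : A →ₐ[k] A ⊗[k] A} {ε : A →ₐ[k] k} {S : A →ₐ[k] A}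
    (hΔ : Δ t = t ⊗ₜ[k] (1 : A) + (1 : A) ⊗ₜ[k] t + a • ((t ^ p ^ m) ⊗ₜ[k] (t ^ p)))
    (hε : ε t = 0) (hS : S t = -t + a • t ^ (p ^ m + p)) :
    IsHopfAlgebraStructure k A Δ ε S.toLinearMap := by
  have hp0 : p ≠ 0 := hp.ne_zero
  have hpm : p ^ m ≠ 0 := pow_ne_zero _ hp0
  have hq : (t ^ p) ^ p ^ m = 0 := by rw [← pow_mul, ← pow_succ', ht0]
  have hq' : (t ^ p ^ m) ^ p = 0 := by rw [← pow_mul, ← pow_succ, ht0]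
  have hΔq : Δ t ^ p ^ m = (t ^ p ^ m) ⊗ₜ[k] (1 : A) + (1 : A) ⊗ₜ[k] (t ^ p ^ m) := by
    rw [hΔ, twistedSum_pow_char_pow p a t _ _ m (.inr hq)]
  have hΔp : Δ t ^ p = (t ^ p) ⊗ₜ[k] (1 : A) + (1 : A) ⊗ₜ[k] (t ^ p) := by
    rw [hΔ]
    simpa using twistedSum_pow_char_pow p a t (t ^ p ^ m) (t ^ p) 1 (.inl (by simpa using hq'))
  have hneg (j : ℕ) : (-t) ^ p ^ j = -t ^ p ^ j := by
    have h := sub_pow_expChar_pow (p := p) (n := j) (0 : A) t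
    rwa [zero_sub, zero_pow (pow_ne_zero _ hp0), zero_sub] at h
  have hSq : S t ^ p ^ m = -t ^ p ^ m := by
    rw [hS, add_pow_expChar_pow, smul_pow, hneg, pow_add, mul_pow, hq]
    simp
  have hSp : S t ^ p = -t ^ p := by
    have h := hneg 1
    rw [pow_one] at h
    rw [hS, add_pow_expChar, smul_pow, h, pow_add, mul_pow, hq']
    simp
  apply isHopfAlgebraStructure_of_adjoin_eq_top ht
  · rw [hΔ]
    simp only [map_add, map_smul, Algebra.TensorProduct.map_tmul, map_pow, map_one,
      AlgHom.coe_id, id_eq, hΔq, hΔp]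
    simp only [hΔ, TensorProduct.add_tmul, TensorProduct.tmul_add, ← TensorProduct.smul_tmul',
      TensorProduct.tmul_smul, map_add, map_smul, Algebra.TensorProduct.assoc_tmul,
      Algebra.TensorProduct.one_def, smul_add]
    abel
  · simp [hΔ, hε, zero_pow hpm]
  · simp [hΔ, hε, hp0]
  · simp only [hΔ, map_add, map_smul, Algebra.TensorProduct.map_tmul, map_pow, map_one,
      AlgHom.coe_id, id_eq, hSq, hε, map_zero, Algebra.TensorProduct.lmul'_apply_tmul]
    rw [hS, pow_add, neg_mul, smul_neg]
    ring
  · simp only [hΔ, map_add, map_smul, Algebra.TensorProduct.map_tmul, map_pow, map_one,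
      AlgHom.coe_id, id_eq, hSp, hε, map_zero, Algebra.TensorProduct.lmul'_apply_tmul]
    rw [hS, pow_add, mul_neg, smul_neg]
    ring

/-- Let `k` be a field of characteristic `p > 0`, `n ≥ 1` and `a ∈ k`.  There is a Hopf algebra
structure on `k[T]/(T^{p^n})` whose comultiplication is the `k`-algebra map with
`Δ(T̄) = T̄⊗1 + 1⊗T̄ + a • T̄^{p^{n-1}} ⊗ T̄^p` and whose counit sends `T̄` to `0`. -/
theorem stmt_8 (k : Type*) [Field k] (p n : ℕ) (hp : p.Prime) (hchar : CharP k p)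
    (hn : 1 ≤ n) (a : k) :
    ∃ (Δ : TruncPoly k (p ^ n) →ₐ[k] TruncPoly k (p ^ n) ⊗[k] TruncPoly k (p ^ n))
      (ε : TruncPoly k (p ^ n) →ₐ[k] k) (S : TruncPoly k (p ^ n) →ₗ[k] TruncPoly k (p ^ n)),
      IsHopfAlgebraStructure k (TruncPoly k (p ^ n)) Δ ε S ∧
      Δ (truncT k (p ^ n)) =
        truncT k (p ^ n) ⊗ₜ[k] (1 : TruncPoly k (p ^ n)) + (1 : TruncPoly k (p ^ n)) ⊗ₜ[k] truncT k (p ^ n) +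
          a • ((truncT k (p ^ n) ^ p ^ (n - 1)) ⊗ₜ[k] (truncT k (p ^ n) ^ p)) ∧
      ε (truncT k (p ^ n)) = 0 := by
  obtain ⟨m, rfl⟩ : ∃ m, n = m + 1 := ⟨n - 1, by omega⟩
  rw [Nat.add_sub_cancel]
  have hp0 : p ≠ 0 := hp.ne_zero
  have hN : p ^ (m + 1) ≠ 0 := pow_ne_zero _ hp0
  have := nontrivial_truncPoly k hN
  have : ExpChar k p := .prime hp
  have : ExpChar (TruncPoly k (p ^ (m + 1))) p :=
    expChar_of_injective_algebraMap (algebraMap k _).injective p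
  have : ExpChar (TruncPoly k (p ^ (m + 1)) ⊗[k] TruncPoly k (p ^ (m + 1))) p :=
    expChar_of_injective_algebraMap (algebraMap k _).injective p
  have ht0 := truncT_pow_self k (p ^ (m + 1))
  generalize htt : truncT k (p ^ (m + 1)) = t at ht0 ⊢
  have hΔ : (t ⊗ₜ[k] 1 + 1 ⊗ₜ[k] t + a • ((t ^ p ^ m) ⊗ₜ[k] (t ^ p))) ^ p ^ (m + 1) = 0 := by
    rw [twistedSum_pow_char_pow p a t _ _ (m + 1) (.inr (by rw [pow_right_comm, ht0, zero_pow hp0])),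
      ht0]
    simp
  have hS : (-t + a • t ^ (p ^ m + p)) ^ p ^ (m + 1) = 0 := by
    have h : -t + a • t ^ (p ^ m + p) = t * (-1 + a • t ^ (p ^ m + p - 1)) := by
      rw [mul_add, mul_smul_comm, mul_pow_sub_one (by omega)]
      ring
    rw [h, mul_pow, ht0, zero_mul]
  subst htt
  let B := TruncPoly k (p ^ (m + 1)) ⊗[k] TruncPoly k (p ^ (m + 1))
  have hΔt := truncLift_truncT (k := k) (B := B) _ hΔ
  have hεt := truncLift_truncT (k := k) (0 : k) (zero_pow hN)
  have hSt := truncLift_truncT (k := k) _ hS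
  refine ⟨truncLift (B := B) _ hΔ, truncLift 0 (zero_pow hN), (truncLift _ hS).toLinearMap,
    ?_, hΔt, hεt⟩
  exact isHopfAlgebraStructure_of_twistedSum hp a (adjoin_truncT k _) ht0 hΔt hεt hSt
end

section
/- Let k be a field of characteristic p > 0 and n ≥ 1. There exists a Hopf algebra structure over k on k[S,T]/(S^p, T^{p^n}) whose comultiplication Δ is the (unique) k-algebra homomorphism to the tensor square satisfying Δ(S̄) = S̄⊗1 + 1⊗S̄ and Δ(T̄) = T̄⊗1 + 1⊗T̄ + T̄^{p}⊗S̄, and whose counit sends S̄ and T̄ to 0. (In particular Δ is well defined, coassociative, counital, and admits an antipode.) -/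
open scoped TensorProduct

theorem add_pow_prime_pow_of_natCast_eq_zero {R : Type*} [CommRing R] {p : ℕ} (hp : p.Prime)
    (h : (p : R) = 0) (x y : R) (m : ℕ) : (x + y) ^ p ^ m = x ^ p ^ m + y ^ p ^ m := by
  obtain ⟨r, hr⟩ := exists_add_pow_prime_pow_eq hp x y m
  simp [hr, h]

theorem add_pow_prime_of_natCast_eq_zero {R : Type*} [CommRing R] {p : ℕ} (hp : p.Prime)
    (h : (p : R) = 0) (x y : R) : (x + y) ^ p = x ^ p + y ^ p := by
  simpa using add_pow_prime_pow_of_natCast_eq_zero hp h x y 1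

namespace TruncPoly₂

variable {k : Type*} [CommRing k] {M N : ℕ}

theorem truncS₂_pow : truncS₂ k M N ^ M = 0 := by
  rw [← map_pow, Ideal.Quotient.eq_zero_iff_mem]
  exact Ideal.subset_span (by simp)

theorem truncT₂_pow : truncT₂ k M N ^ N = 0 := by
  rw [← map_pow, Ideal.Quotient.eq_zero_iff_mem]
  exact Ideal.subset_span (by simp)

/-- The `k`-algebra homomorphism out of `k[S,T]/(S^M, T^N)` sending `S` to `x` and `T` to `y`. -/
noncomputable def lift {B : Type*} [CommRing B] [Algebra k B] (x y : B) (hx : x ^ M = 0)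
    (hy : y ^ N = 0) : TruncPoly₂ k M N →ₐ[k] B :=
  Ideal.Quotient.liftₐ _ (MvPolynomial.aeval ![x, y]) fun a ha => by
    have : Ideal.span {(MvPolynomial.X 0 : MvPolynomial (Fin 2) k) ^ M, (MvPolynomial.X 1) ^ N} ≤
        RingHom.ker (MvPolynomial.aeval (R := k) ![x, y]) := by
      rw [Ideal.span_le]
      rintro _ (rfl | rfl) <;> simp [hx, hy]
    exact this ha

section lift

variable {B : Type*} [CommRing B] [Algebra k B] (x y : B) (hx : x ^ M = 0) (hy : y ^ N = 0)

@[simp]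
theorem lift_truncS₂ : lift x y hx hy (truncS₂ k M N) = x := by
  change MvPolynomial.aeval ![x, y] (MvPolynomial.X 0) = x
  simp

@[simp]
theorem lift_truncT₂ : lift x y hx hy (truncT₂ k M N) = y := by
  change MvPolynomial.aeval ![x, y] (MvPolynomial.X 1) = y
  simp

end lift

theorem algHom_ext {B : Type*} [CommRing B] [Algebra k B] {f g : TruncPoly₂ k M N →ₐ[k] B}
    (hS : f (truncS₂ k M N) = g (truncS₂ k M N))
    (hT : f (truncT₂ k M N) = g (truncT₂ k M N)) : f = g := by
  apply Ideal.Quotient.algHom_ext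
  apply MvPolynomial.algHom_ext
  intro i
  fin_cases i
  · exact hS
  · exact hT

end TruncPoly₂

/-- When the antipode is an algebra homomorphism, the Hopf algebra axioms are equalities of
algebra homomorphisms. -/
theorem IsHopfAlgebraStructure.of_algHom {k A : Type*} [CommRing k] [CommRing A] [Algebra k A]
    {Δ : A →ₐ[k] A ⊗[k] A} {ε : A →ₐ[k] k} {S : A →ₐ[k] A}
    (coassoc : ((Algebra.TensorProduct.assoc k k k A A A).toAlgHom.comp
      (Algebra.TensorProduct.map Δ (AlgHom.id k A))).comp Δ =
      (Algebra.TensorProduct.map (AlgHom.id k A) Δ).comp Δ)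
    (counit_left : ((Algebra.TensorProduct.lid k A).toAlgHom.comp
      (Algebra.TensorProduct.map ε (AlgHom.id k A))).comp Δ = AlgHom.id k A)
    (counit_right : ((Algebra.TensorProduct.rid k k A).toAlgHom.comp
      (Algebra.TensorProduct.map (AlgHom.id k A) ε)).comp Δ = AlgHom.id k A)
    (antipode_left : ((Algebra.TensorProduct.lmul' k (S := A)).comp
      (Algebra.TensorProduct.map S (AlgHom.id k A))).comp Δ = (Algebra.ofId k A).comp ε)
    (antipode_right : ((Algebra.TensorProduct.lmul' k (S := A)).comp
      (Algebra.TensorProduct.map (AlgHom.id k A) S)).comp Δ = (Algebra.ofId k A).comp ε) :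
    IsHopfAlgebraStructure k A Δ ε S.toLinearMap :=
  ⟨DFunLike.congr_fun coassoc, DFunLike.congr_fun counit_left, DFunLike.congr_fun counit_right,
    DFunLike.congr_fun antipode_left, DFunLike.congr_fun antipode_right⟩

universe u in
/-- A `k`-algebra with the universal property of `k[s,t]/(s^p, t^{p^n})` is a Hopf algebra with
`Δ(s) = s ⊗ 1 + 1 ⊗ s` and `Δ(t) = t ⊗ 1 + 1 ⊗ t + t^p ⊗ s`. The antipode sends `s` to `-s` and
`t` to `-t + t^p s`. -/
theorem IsHopfAlgebraStructure.exists_of_lift {k A : Type u} [Field k] [CommRing A] [Algebra k A]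
    {p n : ℕ} (hp : p.Prime) [CharP k p] {s t : A} (hs : s ^ p = 0) (ht : t ^ p ^ n = 0)
    (lift : ∀ {B : Type u} [CommRing B] [Algebra k B] (x y : B), x ^ p = 0 → y ^ p ^ n = 0 →
      ∃ f : A →ₐ[k] B, f s = x ∧ f t = y)
    (ext : ∀ {B : Type u} [CommRing B] [Algebra k B] {f g : A →ₐ[k] B},
      f s = g s → f t = g t → f = g) :
    ∃ (Δ : A →ₐ[k] A ⊗[k] A) (ε : A →ₐ[k] k) (S : A →ₗ[k] A),
      IsHopfAlgebraStructure k A Δ ε S ∧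
      Δ s = s ⊗ₜ[k] (1 : A) + (1 : A) ⊗ₜ[k] s ∧
      Δ t = t ⊗ₜ[k] (1 : A) + (1 : A) ⊗ₜ[k] t + (t ^ p) ⊗ₜ[k] s ∧
      ε s = 0 ∧ ε t = 0 := by
  have hpn : p ^ n ≠ 0 := pow_ne_zero _ hp.ne_zero
  have hk : (p : k) = 0 := CharP.cast_eq_zero k p
  have natCast_eq_zero (B : Type u) [CommRing B] [Algebra k B] : (p : B) = 0 := by
    rw [← map_natCast (algebraMap k B), hk, map_zero]
  have htp : (t ^ p) ^ p ^ n = 0 := by rw [pow_right_comm, ht, zero_pow hp.ne_zero]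
  have hA := natCast_eq_zero A
  have hAA := natCast_eq_zero (A ⊗[k] A)
  have hΔs : (s ⊗ₜ[k] (1 : A) + (1 : A) ⊗ₜ[k] s) ^ p = 0 := by
    simp [add_pow_prime_of_natCast_eq_zero hp hAA, hs]
  have hΔt : (t ⊗ₜ[k] (1 : A) + (1 : A) ⊗ₜ[k] t + (t ^ p) ⊗ₜ[k] s) ^ p ^ n = 0 := by
    simp only [add_pow_prime_pow_of_natCast_eq_zero hp hAA, Algebra.TensorProduct.tmul_pow, ht,
      htp, TensorProduct.zero_tmul, TensorProduct.tmul_zero, add_zero]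
  have hΔtp : (t ⊗ₜ[k] (1 : A) + (1 : A) ⊗ₜ[k] t + (t ^ p) ⊗ₜ[k] s) ^ p =
      (t ^ p) ⊗ₜ[k] (1 : A) + (1 : A) ⊗ₜ[k] (t ^ p) := by
    simp only [add_pow_prime_of_natCast_eq_zero hp hAA, Algebra.TensorProduct.tmul_pow, hs,
      one_pow, TensorProduct.tmul_zero, add_zero]
  have hσs : (-s) ^ p = 0 := by rw [neg_pow, hs, mul_zero]
  have hσt : (-t + t ^ p * s) ^ p ^ n = 0 := by
    rw [add_pow_prime_pow_of_natCast_eq_zero hp hA, mul_pow, htp, neg_pow, ht, mul_zero, zero_mul,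
      add_zero]
  have hσtp : (-t + t ^ p * s) ^ p + t ^ p = 0 := by
    rw [← add_pow_prime_of_natCast_eq_zero hp hA, neg_add_cancel_comm, mul_pow, hs, mul_zero]
  obtain ⟨Δ, Δs, Δt⟩ := lift _ _ hΔs hΔt
  obtain ⟨ε, εs, εt⟩ := lift (0 : k) 0 (zero_pow hp.ne_zero) (zero_pow hpn)
  obtain ⟨σ, σs, σt⟩ := lift _ _ hσs hσt
  refine ⟨Δ, ε, σ.toLinearMap, .of_algHom ?_ ?_ ?_ ?_ ?_, Δs, Δt, εs, εt⟩ <;>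
    refine ext (?_ : _ = _) (?_ : _ = _)
  · change Algebra.TensorProduct.assoc k k k A A A
      (Algebra.TensorProduct.map Δ (AlgHom.id k A) (Δ s)) =
      Algebra.TensorProduct.map (AlgHom.id k A) Δ (Δ s)
    simp [Δs, TensorProduct.add_tmul, TensorProduct.tmul_add, Algebra.TensorProduct.one_def,
      add_assoc]
  · change Algebra.TensorProduct.assoc k k k A A A
      (Algebra.TensorProduct.map Δ (AlgHom.id k A) (Δ t)) =
      Algebra.TensorProduct.map (AlgHom.id k A) Δ (Δ t)
    simp [Δs, Δt, hΔtp, TensorProduct.add_tmul, TensorProduct.tmul_add,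
      Algebra.TensorProduct.one_def]
    abel
  · change Algebra.TensorProduct.lid k A (Algebra.TensorProduct.map ε (AlgHom.id k A) (Δ s)) = s
    simp [Δs, εs]
  · change Algebra.TensorProduct.lid k A (Algebra.TensorProduct.map ε (AlgHom.id k A) (Δ t)) = t
    simp [Δt, εt, hp.ne_zero]
  · change Algebra.TensorProduct.rid k k A (Algebra.TensorProduct.map (AlgHom.id k A) ε (Δ s)) = s
    simp [Δs, εs]
  · change Algebra.TensorProduct.rid k k A (Algebra.TensorProduct.map (AlgHom.id k A) ε (Δ t)) = t
    simp [Δt, εt, εs]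
  · change Algebra.TensorProduct.lmul' k (Algebra.TensorProduct.map σ (AlgHom.id k A) (Δ s)) =
      algebraMap k A (ε s)
    simp [Δs, εs, σs]
  · change Algebra.TensorProduct.lmul' k (Algebra.TensorProduct.map σ (AlgHom.id k A) (Δ t)) =
      algebraMap k A (ε t)
    simp [Δt, εt, σt]
    linear_combination s * hσtp
  · change Algebra.TensorProduct.lmul' k (Algebra.TensorProduct.map (AlgHom.id k A) σ (Δ s)) =
      algebraMap k A (ε s)
    simp [Δs, εs, σs]
  · change Algebra.TensorProduct.lmul' k (Algebra.TensorProduct.map (AlgHom.id k A) σ (Δ t)) =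
      algebraMap k A (ε t)
    simp [Δt, εt, σt, σs]

/-- Let `k` be a field of characteristic `p > 0` and `n ≥ 1`.  There is a Hopf algebra
structure on `k[S,T]/(S^p, T^{p^n})` whose comultiplication is the `k`-algebra map with
`Δ(S̄) = S̄⊗1 + 1⊗S̄` and `Δ(T̄) = T̄⊗1 + 1⊗T̄ + T̄^p ⊗ S̄`, and whose counit sends `S̄` and
`T̄` to `0`.  This is the Hopf algebra of functions of `D_n = α_{p^n} ⋊ α_p`. -/
theorem stmt_9 (k : Type*) [Field k] (p n : ℕ) (hp : p.Prime) (hchar : CharP k p)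
    (hn : 1 ≤ n) :
    ∃ (Δ : TruncPoly₂ k p (p ^ n) →ₐ[k] TruncPoly₂ k p (p ^ n) ⊗[k] TruncPoly₂ k p (p ^ n))
      (ε : TruncPoly₂ k p (p ^ n) →ₐ[k] k)
      (S : TruncPoly₂ k p (p ^ n) →ₗ[k] TruncPoly₂ k p (p ^ n)),
      IsHopfAlgebraStructure k (TruncPoly₂ k p (p ^ n)) Δ ε S ∧
      Δ (truncS₂ k p (p ^ n)) =
        truncS₂ k p (p ^ n) ⊗ₜ[k] (1 : TruncPoly₂ k p (p ^ n)) +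
          (1 : TruncPoly₂ k p (p ^ n)) ⊗ₜ[k] truncS₂ k p (p ^ n) ∧
      Δ (truncT₂ k p (p ^ n)) =
        truncT₂ k p (p ^ n) ⊗ₜ[k] (1 : TruncPoly₂ k p (p ^ n)) +
          (1 : TruncPoly₂ k p (p ^ n)) ⊗ₜ[k] truncT₂ k p (p ^ n) +
          (truncT₂ k p (p ^ n) ^ p) ⊗ₜ[k] truncS₂ k p (p ^ n) ∧
      ε (truncS₂ k p (p ^ n)) = 0 ∧ ε (truncT₂ k p (p ^ n)) = 0 := by
  exact IsHopfAlgebraStructure.exists_of_lift hp TruncPoly₂.truncS₂_pow TruncPoly₂.truncT₂_pow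
    (fun x y hx hy => ⟨TruncPoly₂.lift x y hx hy, TruncPoly₂.lift_truncS₂ x y hx hy,
      TruncPoly₂.lift_truncT₂ x y hx hy⟩) TruncPoly₂.algHom_ext
end

section
/- Let k be a field of characteristic p > 0 and n ≥ 2. Let A = k[S,T]/(S^p, T^{p^n}) with the bialgebra structure in which Δ(S̄) = S̄⊗1 + 1⊗S̄, Δ(T̄) = T̄⊗1 + 1⊗T̄ + T̄^{p}⊗S̄, and the counit sends S̄, T̄ to 0. Then an element P ∈ A is primitive (i.e. Δ(P) = P⊗1 + 1⊗P) if and only if P lies in the k-linear span of the elements S̄, T̄^{p}, T̄^{p²}, …, T̄^{p^{n−1}}. -/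
open scoped TensorProduct

/-- `(Δ, ε)` is a bialgebra structure on the `k`-algebra `A`: the comultiplication `Δ` and
counit `ε` are `k`-algebra homomorphisms, `Δ` is coassociative and `ε` is a counit for `Δ`. -/
def IsBialgebraStructure (k A : Type*) [CommRing k] [CommRing A] [Algebra k A]
    (Δ : A →ₐ[k] A ⊗[k] A) (ε : A →ₐ[k] k) : Prop :=
  (∀ x : A, (TensorProduct.assoc k A A A)
      ((TensorProduct.map Δ.toLinearMap (LinearMap.id : A →ₗ[k] A)) (Δ x))
      = (TensorProduct.map (LinearMap.id : A →ₗ[k] A) Δ.toLinearMap) (Δ x)) ∧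
  (∀ x : A, (TensorProduct.lid k A)
      ((TensorProduct.map ε.toLinearMap (LinearMap.id : A →ₗ[k] A)) (Δ x)) = x) ∧
  (∀ x : A, (TensorProduct.rid k A)
      ((TensorProduct.map (LinearMap.id : A →ₗ[k] A) ε.toLinearMap) (Δ x)) = x)

open Polynomial in
/-- The coefficient functionals `cᵤ ⊗ cᵥ` read off the binomial expansion of
`f (x ⊗ 1 + 1 ⊗ x)`. -/
lemma mul'_map_aeval_tmul_add {k A : Type*} [Field k] [CommRing A] [Algebra k A] {M : ℕ} {x : A}
    (c : ℕ → A →ₗ[k] k) (hc : ∀ (f : k[X]) (j : ℕ), j < M → c j (aeval x f) = f.coeff j)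
    (f : k[X]) {u v : ℕ} (hu : u < M) (hv : v < M) :
    LinearMap.mul' k k (TensorProduct.map (c u) (c v)
      (aeval (x ⊗ₜ[k] (1 : A) + (1 : A) ⊗ₜ[k] x) f)) = f.coeff (u + v) * (u + v).choose u := by
  have hpow : ∀ i j, j < M → c j (x ^ i) = if i = j then 1 else 0 := fun i j hj => by
    simpa [coeff_X_pow, eq_comm] using hc (X ^ i) j hj
  induction f using Polynomial.induction_on' with
  | add f g hf hg => simp only [map_add, hf, hg, coeff_add, add_mul]
  | monomial n a =>
    have hexp : (x ⊗ₜ[k] (1 : A) + (1 : A) ⊗ₜ[k] x) ^ n =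
        ∑ m ∈ Finset.HasAntidiagonal.antidiagonal n,
          n.choose m.1 • ((x ^ m.1) ⊗ₜ[k] (x ^ m.2)) := by
      rw [(Commute.all _ _).add_pow']
      simp [Algebra.TensorProduct.tmul_pow]
    rw [aeval_monomial, ← Algebra.smul_def, hexp, map_smul, map_smul, map_sum, map_sum,
      coeff_monomial, smul_eq_mul]
    have hterm : ∀ m ∈ Finset.HasAntidiagonal.antidiagonal n,
        LinearMap.mul' k k (TensorProduct.map (c u) (c v)
          (n.choose m.1 • ((x ^ m.1) ⊗ₜ[k] (x ^ m.2)))) =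
        if m = (u, v) then (n.choose u : k) else 0 := by
      rintro ⟨i, j⟩ -
      rw [map_nsmul, map_nsmul, TensorProduct.map_tmul, LinearMap.mul'_apply, hpow i u hu,
        hpow j v hv]
      by_cases hi : i = u <;> by_cases hj : j = v <;> simp [hi, hj]
    rw [Finset.sum_congr rfl hterm, Finset.sum_ite_eq']
    by_cases hn : n = u + v
    · simp [hn]
    · simp [hn, Ne.symm hn]

/-- A number `d ≠ 0` that is not a power of `p` has a proper binomial coefficient prime to `p`. -/
lemma exists_choose_not_dvd {p d : ℕ} (hp : p.Prime) (hd : d ≠ 0) (hpow : ∀ i, d ≠ p ^ i) :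
    ∃ u v, u ≠ 0 ∧ v ≠ 0 ∧ u + v = d ∧ ¬ p ∣ d.choose u := by
  have : Fact p.Prime := ⟨hp⟩
  obtain ⟨e, m, hpm, rfl⟩ := Nat.exists_eq_pow_mul_and_not_dvd hd p hp.ne_one
  have hm0 : m ≠ 0 := by rintro rfl; simp at hpm
  have hm1 : m ≠ 1 := by rintro rfl; exact hpow e (by simp)
  have hpe : 0 < p ^ e := pow_pos hp.pos e
  refine ⟨p ^ e * 1, p ^ e * (m - 1), by simpa using hpe.ne', ?_, ?_, fun h => hpm ?_⟩
  · exact mul_ne_zero hpe.ne' (by omega)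
  · rw [← mul_add]; congr 1; omega
  · have := Choose.choose_pow_mul_pow_mul_modEq_choose_nat (p := p) (k := e) (a := m) (b := 1)
    rw [Nat.choose_one_right] at this
    exact (this.dvd_iff dvd_rfl).mp h

open Polynomial in
/-- Primitive polynomials in a primitive element of height `m` are additive. -/
lemma aeval_eq_sum_of_aeval_tmul_add {k A : Type*} [Field k] [CommRing A] [Algebra k A]
    {p m : ℕ} (hp : p.Prime) [CharP k p] {x : A} (hx : x ^ p ^ m = 0)
    (c : ℕ → A →ₗ[k] k) (hc : ∀ (f : k[X]) (j : ℕ), j < p ^ m → c j (aeval x f) = f.coeff j)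
    (f : k[X])
    (hf : aeval (x ⊗ₜ[k] (1 : A) + (1 : A) ⊗ₜ[k] x) f =
      aeval x f ⊗ₜ[k] (1 : A) + (1 : A) ⊗ₜ[k] aeval x f) :
    aeval x f = ∑ i ∈ Finset.range m, f.coeff (p ^ i) • x ^ p ^ i := by
  have hone : ∀ j, j < p ^ m → c j 1 = if j = 0 then 1 else 0 := fun j hj => by
    simpa [coeff_one] using hc 1 j hj
  have key : ∀ u v, u < p ^ m → v < p ^ m → f.coeff (u + v) * (u + v).choose u =
      f.coeff u * (if v = 0 then 1 else 0) + (if u = 0 then 1 else 0) * f.coeff v := by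
    intro u v hu hv
    rw [← mul'_map_aeval_tmul_add c hc f hu hv, hf]
    simp only [map_add, TensorProduct.map_tmul, LinearMap.mul'_apply, hone _ hu, hone _ hv,
      hc _ _ hu, hc _ _ hv]
  have hvanish : ∀ d, d < p ^ m → (∀ i, d ≠ p ^ i) → f.coeff d = 0 := by
    intro d hd hpow
    rcases eq_or_ne d 0 with rfl | hd0
    · simpa using key 0 0 hd hd
    obtain ⟨u, v, hu, hv, rfl, hdvd⟩ := exists_choose_not_dvd hp hd0 hpow
    have h := key u v (by omega) (by omega)
    rw [if_neg hu, if_neg hv, mul_zero, zero_mul, add_zero, mul_eq_zero] at h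
    exact h.resolve_right fun h0 => hdvd ((CharP.cast_eq_zero_iff k p _).mp h0)
  set g : k[X] := ∑ i ∈ Finset.range m, C (f.coeff (p ^ i)) * X ^ p ^ i with hg
  have hdvd : X ^ p ^ m ∣ f - g := by
    rw [X_pow_dvd_iff]
    intro d hd
    simp only [hg, coeff_sub, finsetSum_coeff, coeff_C_mul, coeff_X_pow]
    by_cases hpow : ∃ i, d = p ^ i
    · obtain ⟨i, rfl⟩ := hpow
      have him : i < m := (Nat.pow_lt_pow_iff_right hp.one_lt).mp hd
      simp [Nat.pow_right_inj hp.two_le, him]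
    · push Not at hpow
      simp [hvanish d hd hpow, hpow]
  obtain ⟨q, hq⟩ := hdvd
  have h := congrArg (aeval x) hq
  rw [map_sub, map_mul, map_pow, aeval_X, hx, zero_mul, sub_eq_zero] at h
  simp [h, hg, Algebra.smul_def]

open Polynomial in
/-- Primitive elements of a bialgebra generated by `S` and `T` with
`Δ S = S ⊗ 1 + 1 ⊗ S` and `Δ T = T ⊗ 1 + 1 ⊗ T + T ^ p ⊗ S`, where `πS` and `πT` are the
projections killing `T` and `S`. -/
lemma primitive_iff_of_generators {k A : Type*} [Field k] [CommRing A] [Algebra k A]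
    {p n : ℕ} (hp : p.Prime) [CharP k p] (hn : 2 ≤ n) {S T : A}
    (hgen : ∀ P : A, ∃ f : MvPolynomial (Fin 2) k, P = MvPolynomial.aeval ![S, T] f)
    (hS : S ^ p = 0) (hT : T ^ p ^ n = 0)
    (cS cT : ℕ → A →ₗ[k] k)
    (hcS : ∀ (f : k[X]) (j : ℕ), j < p → cS j (aeval S f) = f.coeff j)
    (hcT : ∀ (f : k[X]) (j : ℕ), j < p ^ n → cT j (aeval T f) = f.coeff j)
    (πS πT : A →ₐ[k] A) (hSS : πS S = S) (hST : πS T = 0) (hTS : πT S = 0) (hTT : πT T = T)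
    (Δ : A →ₐ[k] A ⊗[k] A)
    (hΔS : Δ S = S ⊗ₜ[k] (1 : A) + (1 : A) ⊗ₜ[k] S)
    (hΔT : Δ T = T ⊗ₜ[k] (1 : A) + (1 : A) ⊗ₜ[k] T + (T ^ p) ⊗ₜ[k] S) (P : A) :
    Δ P = P ⊗ₜ[k] (1 : A) + (1 : A) ⊗ₜ[k] P ↔
      ∃ (b : k) (a : Fin (n - 1) → k),
        P = b • S + ∑ i : Fin (n - 1), a i • T ^ p ^ ((i : ℕ) + 1) := by
  have hp0 : p ≠ 0 := hp.ne_zero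
  have hpn : p < p ^ n := by
    simpa using Nat.pow_lt_pow_right hp.one_lt (show 1 < n by omega)
  have hcSS : cS 1 S = 1 := by simpa using hcS X 1 hp.one_lt
  have hcTT : cT p (T ^ p) = 1 := by simpa using hcT (X ^ p) p hpn
  have : Nontrivial (A ⊗[k] A) := by
    refine ⟨(T ^ p) ⊗ₜ[k] S, 0, fun h => ?_⟩
    simpa [hcSS, hcTT] using congrArg (LinearMap.mul' k k ∘ TensorProduct.map (cT p) (cS 1)) h
  have : CharP (A ⊗[k] A) p := charP_of_injective_algebraMap (algebraMap k _).injective p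
  have : ExpChar (A ⊗[k] A) p := ExpChar.prime hp
  have hΔpow : ∀ i, Δ (T ^ p ^ (i + 1)) =
      (T ^ p ^ (i + 1)) ⊗ₜ[k] (1 : A) + (1 : A) ⊗ₜ[k] (T ^ p ^ (i + 1)) := by
    intro i
    have hSi : S ^ p ^ (i + 1) = 0 := by rw [pow_succ', pow_mul, hS, zero_pow (by positivity)]
    rw [map_pow, hΔT, add_pow_expChar_pow, add_pow_expChar_pow]
    simp [Algebra.TensorProduct.tmul_pow, hSi]
  constructor
  · intro hP
    have hsum : P = πS P + πT P := by
      have hid : ((Algebra.TensorProduct.productMap πS πT).comp Δ) P = P := by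
        obtain ⟨f, rfl⟩ := hgen P
        rw [← AlgHom.comp_apply, MvPolynomial.comp_aeval]
        congr 2
        funext i
        fin_cases i <;> simp [hΔS, hΔT, hSS, hST, hTS, hTT, hp0]
      conv_lhs => rw [← hid, AlgHom.comp_apply, hP]
      simp
    obtain ⟨f, hf⟩ := hgen P
    have hprim : ∀ (π : A →ₐ[k] A) (x : A) (F : k[X]), π P = aeval x F →
        (Algebra.TensorProduct.map π π) (Δ P) =
          aeval (x ⊗ₜ[k] (1 : A) + (1 : A) ⊗ₜ[k] x) F →
        aeval (x ⊗ₜ[k] (1 : A) + (1 : A) ⊗ₜ[k] x) F =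
          aeval x F ⊗ₜ[k] (1 : A) + (1 : A) ⊗ₜ[k] aeval x F := by
      intro π x F hx h
      rw [← h, hP, ← hx]
      simp
    have hSP : πS P = aeval S (MvPolynomial.aeval ![(X : k[X]), 0] f) := by
      rw [hf, ← AlgHom.comp_apply, ← AlgHom.comp_apply, MvPolynomial.comp_aeval,
        MvPolynomial.comp_aeval]
      congr 2
      funext i
      fin_cases i <;> simp [hSS, hST]
    have hTP : πT P = aeval T (MvPolynomial.aeval ![0, (X : k[X])] f) := by
      rw [hf, ← AlgHom.comp_apply, ← AlgHom.comp_apply, MvPolynomial.comp_aeval,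
        MvPolynomial.comp_aeval]
      congr 2
      funext i
      fin_cases i <;> simp [hTT, hTS]
    have hSadd := aeval_eq_sum_of_aeval_tmul_add (m := 1) hp (by simpa using hS) cS
      (by simpa using hcS) _ (hprim πS S _ hSP (by
        rw [hf, ← AlgHom.comp_apply, ← AlgHom.comp_apply, ← AlgHom.comp_apply,
          MvPolynomial.comp_aeval, MvPolynomial.comp_aeval]
        congr 2
        funext i
        fin_cases i <;> simp [hΔS, hΔT, hSS, hST, hp0]))
    have hTadd := aeval_eq_sum_of_aeval_tmul_add hp hT cT hcT _ (hprim πT T _ hTP (by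
        rw [hf, ← AlgHom.comp_apply, ← AlgHom.comp_apply, ← AlgHom.comp_apply,
          MvPolynomial.comp_aeval, MvPolynomial.comp_aeval]
        congr 2
        funext i
        fin_cases i <;> simp [hΔS, hΔT, hTT, hTS]))
    rw [← hSP] at hSadd
    rw [← hTP] at hTadd
    set b := (MvPolynomial.aeval ![(X : k[X]), 0] f).coeff (p ^ 0)
    set a : ℕ → k := fun i => (MvPolynomial.aeval ![0, (X : k[X])] f).coeff (p ^ i) with ha
    obtain ⟨l, rfl⟩ : ∃ l, n = l + 1 := ⟨n - 1, by omega⟩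
    have hPeq : P = b • S + (∑ i ∈ Finset.range l, a (i + 1) • T ^ p ^ (i + 1) + a 0 • T) := by
      rw [hsum, hSadd, hTadd, Finset.sum_range_succ' _ l]
      simp [ha, b]
    have ha0 : a 0 = 0 := by
      have h := hP
      rw [hPeq] at h
      simp only [map_add, map_smul, map_sum, hΔS, hΔT, hΔpow, TensorProduct.add_tmul,
        TensorProduct.tmul_add, TensorProduct.sum_tmul, TensorProduct.tmul_sum, smul_add,
        ← TensorProduct.smul_tmul', TensorProduct.tmul_smul, Finset.sum_add_distrib] at h
      have h' : a 0 • ((T ^ p) ⊗ₜ[k] S) = 0 := by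
        rw [← sub_eq_zero] at h
        rw [← h]
        abel
      simpa [hcSS, hcTT] using
        congrArg (LinearMap.mul' k k ∘ TensorProduct.map (cT p) (cS 1)) h'
    refine ⟨b, fun i => a (i + 1), ?_⟩
    rw [hPeq, ha0, zero_smul, add_zero, Finset.sum_range]
    rfl
  · rintro ⟨b, a, rfl⟩
    simp only [map_add, map_smul, map_sum, hΔS, hΔpow, TensorProduct.add_tmul,
      TensorProduct.tmul_add, TensorProduct.sum_tmul, TensorProduct.tmul_sum, smul_add,
      ← TensorProduct.smul_tmul', TensorProduct.tmul_smul, Finset.sum_add_distrib]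
    abel

open Polynomial in
/-- If `x` maps to the root of `X ^ M` under an algebra map to `k[X]/(X ^ M)`, the first `M`
coefficients of a polynomial expression in `x` are given by linear functionals. -/
lemma exists_coeff_functionals {k A : Type*} [Field k] [CommRing A] [Algebra k A] {M : ℕ} {x : A}
    (φ : A →ₐ[k] AdjoinRoot (X ^ M : k[X])) (hφ : φ x = AdjoinRoot.root (X ^ M : k[X])) :
    ∃ c : ℕ → A →ₗ[k] k, ∀ (f : k[X]) (j : ℕ), j < M → c j (aeval x f) = f.coeff j := by
  have hmonic : (X ^ M : k[X]).Monic := monic_X_pow M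
  refine ⟨fun j => lcoeff k j ∘ₗ AdjoinRoot.modByMonicHom hmonic ∘ₗ φ.toLinearMap,
    fun f j hj => ?_⟩
  have hmod : φ (aeval x f) = AdjoinRoot.mk (X ^ M : k[X]) f := by
    rw [← aeval_algHom_apply, hφ, AdjoinRoot.aeval_eq]
  have hcoeff : (f %ₘ X ^ M).coeff j = f.coeff j := by
    conv_rhs => rw [← modByMonic_add_div f (X ^ M)]
    rw [coeff_add, coeff_X_pow_mul', if_neg (by omega), add_zero]
  simp [hmod, hcoeff]

/-- The algebra map out of `k[S,T]/(S^M, T^N)` with prescribed values on `S` and `T`. -/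
lemma exists_truncPoly₂_algHom {k B : Type*} [Field k] [CommRing B] [Algebra k B] {M N : ℕ}
    {s t : B} (hs : s ^ M = 0) (ht : t ^ N = 0) :
    ∃ φ : TruncPoly₂ k M N →ₐ[k] B, φ (truncS₂ k M N) = s ∧ φ (truncT₂ k M N) = t := by
  refine ⟨Ideal.Quotient.liftₐ _ (MvPolynomial.aeval ![s, t]) ?_, ?_, ?_⟩
  · intro a ha
    have hle : Ideal.span {(MvPolynomial.X 0 : MvPolynomial (Fin 2) k) ^ M,
        (MvPolynomial.X 1) ^ N} ≤ RingHom.ker (MvPolynomial.aeval (R := k) ![s, t]) := by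
      rw [Ideal.span_le]
      rintro _ (rfl | rfl) <;> simp [hs, ht]
    exact hle ha
  · exact (Ideal.Quotient.lift_mk _ _ _).trans (by simp)
  · exact (Ideal.Quotient.lift_mk _ _ _).trans (by simp)

/-- Let `k` be a field of characteristic `p > 0`, `n ≥ 2`, and let `A = k[S,T]/(S^p, T^{p^n})`
carry the bialgebra structure with `Δ(S̄) = S̄⊗1 + 1⊗S̄`,
`Δ(T̄) = T̄⊗1 + 1⊗T̄ + T̄^p ⊗ S̄` and counit sending `S̄, T̄` to `0` (the Hopf algebra of
`D_n = α_{p^n} ⋊ α_p`).  An element `P` is primitive if and only if it lies in the `k`-linear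
span of `S̄, T̄^p, T̄^{p²}, …, T̄^{p^{n-1}}`. -/
theorem stmt_11 (k : Type*) [Field k] (p n : ℕ) (hp : p.Prime) (hchar : CharP k p)
    (hn : 2 ≤ n)
    (Δ : TruncPoly₂ k p (p ^ n) →ₐ[k] TruncPoly₂ k p (p ^ n) ⊗[k] TruncPoly₂ k p (p ^ n))
    (ε : TruncPoly₂ k p (p ^ n) →ₐ[k] k)
    (hbi : IsBialgebraStructure k (TruncPoly₂ k p (p ^ n)) Δ ε)
    (hεS : ε (truncS₂ k p (p ^ n)) = 0) (hεT : ε (truncT₂ k p (p ^ n)) = 0)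
    (hΔS : Δ (truncS₂ k p (p ^ n)) =
      truncS₂ k p (p ^ n) ⊗ₜ[k] (1 : TruncPoly₂ k p (p ^ n)) +
        (1 : TruncPoly₂ k p (p ^ n)) ⊗ₜ[k] truncS₂ k p (p ^ n))
    (hΔT : Δ (truncT₂ k p (p ^ n)) =
      truncT₂ k p (p ^ n) ⊗ₜ[k] (1 : TruncPoly₂ k p (p ^ n)) +
        (1 : TruncPoly₂ k p (p ^ n)) ⊗ₜ[k] truncT₂ k p (p ^ n) +
        (truncT₂ k p (p ^ n) ^ p) ⊗ₜ[k] truncS₂ k p (p ^ n))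
    (P : TruncPoly₂ k p (p ^ n)) :
    (Δ P = P ⊗ₜ[k] (1 : TruncPoly₂ k p (p ^ n)) + (1 : TruncPoly₂ k p (p ^ n)) ⊗ₜ[k] P) ↔
      ∃ (b : k) (a : Fin (n - 1) → k),
        P = b • truncS₂ k p (p ^ n) +
          ∑ i : Fin (n - 1), a i • truncT₂ k p (p ^ n) ^ p ^ ((i : ℕ) + 1) := by
  have hp0 : p ≠ 0 := hp.ne_zero
  have hpn : p ^ n ≠ 0 := pow_ne_zero n hp0
  have hS : truncS₂ k p (p ^ n) ^ p = 0 :=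
    (map_pow _ _ _).symm.trans (Ideal.Quotient.eq_zero_iff_mem.mpr
      (Ideal.subset_span (Set.mem_insert _ _)))
  have hT : truncT₂ k p (p ^ n) ^ p ^ n = 0 :=
    (map_pow _ _ _).symm.trans (Ideal.Quotient.eq_zero_iff_mem.mpr
      (Ideal.subset_span (Set.mem_insert_of_mem _ rfl)))
  have hroot : ∀ M : ℕ,
      AdjoinRoot.root (Polynomial.X ^ M : Polynomial k) ^ M = 0 := fun M => by
    rw [← AdjoinRoot.mk_X, ← map_pow, AdjoinRoot.mk_self]
  obtain ⟨φS, hφS, -⟩ := exists_truncPoly₂_algHom (k := k) (hroot p) (zero_pow hpn)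
  obtain ⟨φT, -, hφT⟩ := exists_truncPoly₂_algHom (k := k) (zero_pow hp0) (hroot (p ^ n))
  obtain ⟨cS, hcS⟩ := exists_coeff_functionals φS hφS
  obtain ⟨cT, hcT⟩ := exists_coeff_functionals φT hφT
  obtain ⟨πS, hSS, hST⟩ := exists_truncPoly₂_algHom (k := k) hS (zero_pow hpn)
  obtain ⟨πT, hTS, hTT⟩ := exists_truncPoly₂_algHom (k := k) (zero_pow hp0) hT
  refine primitive_iff_of_generators hp hn (fun P => ?_) hS hT cS cT hcS hcT πS πT hSS hST hTS hTT
    Δ hΔS hΔT P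
  obtain ⟨f, rfl⟩ := Ideal.Quotient.mk_surjective P
  refine ⟨f, ?_⟩
  have h : Ideal.Quotient.mkₐ k _ =
      MvPolynomial.aeval ![truncS₂ k p (p ^ n), truncT₂ k p (p ^ n)] := by
    ext i
    fin_cases i <;> simp
  exact DFunLike.congr_fun h f
end

section
/- Let k be a field of characteristic p > 0, let n ≥ 1 and a ∈ k, and let A_{a,n} denote k[T]/(T^{p^n}) with the bialgebra structure in which Δ(T̄) = T̄⊗1 + 1⊗T̄ + a·T̄^{p^{n−1}}⊗T̄^{p} and the counit sends T̄ to 0. Then the comultiplication of A_{a,n} is cocommutative (i.e. the flip of the tensor factors composed with Δ equals Δ) if and only if n ≤ 2 or a = 0. -/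
open scoped TensorProduct

/-- The `i`-th coefficient functional on `k[T]/(T^N)`, for `i < N`. -/
noncomputable def truncCoeff (k : Type*) [CommRing k] (N i : ℕ) (hi : i < N) :
    TruncPoly k N →ₗ[k] k :=
  Submodule.liftQ ((Ideal.span {(Polynomial.X : Polynomial k) ^ N}).restrictScalars k)
    (Polynomial.lcoeff k i) (by
      intro f hf
      rw [Submodule.restrictScalars_mem, Ideal.mem_span_singleton] at hf
      exact Polynomial.X_pow_dvd_iff.mp hf i hi)

theorem truncCoeff_truncT_pow (k : Type*) [CommRing k] (N i : ℕ) (hi : i < N) (j : ℕ) :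
    truncCoeff k N i hi (truncT k N ^ j) = if i = j then 1 else 0 := by
  rw [truncT, ← map_pow]
  exact Polynomial.coeff_X_pow j i

/-- Distinct nonzero powers of `T` give a non-symmetric elementary tensor. -/
theorem eq_zero_of_smul_truncT_tmul_comm {k : Type*} [CommRing k] {N i j : ℕ} (hi : i < N)
    (hj : j < N) (hij : i ≠ j) {a : k}
    (h : a • ((truncT k N ^ j) ⊗ₜ[k] (truncT k N ^ i)) =
      a • ((truncT k N ^ i) ⊗ₜ[k] (truncT k N ^ j))) : a = 0 := by
  have := congrArg (fun z => TensorProduct.lid k k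
    (TensorProduct.map (truncCoeff k N i hi) (truncCoeff k N j hj) z)) h
  simpa only [map_smul, TensorProduct.map_tmul, TensorProduct.lid_tmul, truncCoeff_truncT_pow,
    if_true, if_neg hij, zero_smul, smul_zero, smul_eq_mul, mul_one, mul_zero, zero_mul] using this.symm

/-- An algebra homomorphism `k[T]/(T^N) → A ⊗ A` is symmetric as soon as the image of `T` is. -/
theorem comm_apply_eq_of_truncT {k A : Type*} [CommRing k] [CommRing A] [Algebra k A] {N : ℕ}
    (Δ : TruncPoly k N →ₐ[k] A ⊗[k] A)
    (h : TensorProduct.comm k A A (Δ (truncT k N)) = Δ (truncT k N)) (x : TruncPoly k N) :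
    TensorProduct.comm k A A (Δ x) = Δ x := by
  have key : (Algebra.TensorProduct.comm k A A).toAlgHom.comp Δ = Δ :=
    Ideal.Quotient.algHom_ext _ (Polynomial.algHom_ext h)
  exact DFunLike.congr_fun key x

/-- Let `k` be a field of characteristic `p > 0`, `n ≥ 1`, `a ∈ k`, and let `A_{a,n}` be
`k[T]/(T^{p^n})` with the bialgebra structure in which
`Δ(T̄) = T̄⊗1 + 1⊗T̄ + a • T̄^{p^{n-1}} ⊗ T̄^p` and the counit sends `T̄` to `0` (the Hopf
algebra of `H_{a,n}`).  Then `Δ` is cocommutative if and only if `n ≤ 2` or `a = 0`. -/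
theorem stmt_12 (k : Type*) [Field k] (p n : ℕ) (hp : p.Prime) (hchar : CharP k p)
    (hn : 1 ≤ n) (a : k)
    (Δ : TruncPoly k (p ^ n) →ₐ[k] TruncPoly k (p ^ n) ⊗[k] TruncPoly k (p ^ n))
    (ε : TruncPoly k (p ^ n) →ₐ[k] k)
    (hbi : IsBialgebraStructure k (TruncPoly k (p ^ n)) Δ ε)
    (hεT : ε (truncT k (p ^ n)) = 0)
    (hΔT : Δ (truncT k (p ^ n)) =
      truncT k (p ^ n) ⊗ₜ[k] (1 : TruncPoly k (p ^ n)) +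
        (1 : TruncPoly k (p ^ n)) ⊗ₜ[k] truncT k (p ^ n) +
        a • ((truncT k (p ^ n) ^ p ^ (n - 1)) ⊗ₜ[k] (truncT k (p ^ n) ^ p))) :
    (∀ x, (TensorProduct.comm k (TruncPoly k (p ^ n)) (TruncPoly k (p ^ n))) (Δ x) = Δ x) ↔
      (n ≤ 2 ∨ a = 0) := by
  have hcomm : TensorProduct.comm k (TruncPoly k (p ^ n)) (TruncPoly k (p ^ n))
        (Δ (truncT k (p ^ n))) = Δ (truncT k (p ^ n)) ↔
      a • ((truncT k (p ^ n) ^ p) ⊗ₜ[k] (truncT k (p ^ n) ^ p ^ (n - 1))) =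
        a • ((truncT k (p ^ n) ^ p ^ (n - 1)) ⊗ₜ[k] (truncT k (p ^ n) ^ p)) := by
    rw [hΔT]
    simp only [map_add, map_smul, TensorProduct.comm_tmul]
    rw [add_comm ((1 : TruncPoly k (p ^ n)) ⊗ₜ[k] truncT k (p ^ n)), add_right_inj]
  constructor
  · intro h
    by_cases h2 : n ≤ 2
    · exact Or.inl h2
    · refine Or.inr (eq_zero_of_smul_truncT_tmul_comm (Nat.pow_lt_pow_right hp.one_lt (by omega))
        (lt_self_pow₀ hp.one_lt (by omega)) ?_ (hcomm.mp (h _)))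
      exact (lt_self_pow₀ hp.one_lt (by omega)).ne'
  · intro h
    refine comm_apply_eq_of_truncT Δ (hcomm.mpr ?_)
    rcases h with h | rfl
    · obtain rfl | rfl : n = 1 ∨ n = 2 := by omega
      · have hT : truncT k (p ^ 1) ^ p = 0 :=
          (congrArg (truncT k (p ^ 1) ^ ·) (pow_one p).symm).trans (truncT_pow_self k (p ^ 1))
        rw [hT, TensorProduct.zero_tmul, TensorProduct.tmul_zero]
      · rw [Nat.add_one_sub_one, pow_one]
    · rw [zero_smul, zero_smul]
end

section
/- Let k be a field of characteristic p > 0, let n ≥ 1, let a, b ∈ k, and let c ∈ k be invertible with a = b·c^{p^{n−1}+p−1}. Let A_{a,n} denote k[T]/(T^{p^n}) with the bialgebra structure in which Δ(T̄) = T̄⊗1 + 1⊗T̄ + a·T̄^{p^{n−1}}⊗T̄^{p} and the counit sends T̄ to 0, and similarly for A_{b,n}. Then the k-algebra endomorphism of k[T]/(T^{p^n}) determined by T̄ ↦ c·T̄ is a bialgebra isomorphism from A_{b,n} to A_{a,n}. -/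
open scoped TensorProduct

/-- Algebra homomorphisms out of `k[T]/(T^N)` agree as soon as they agree on the class of `T`. -/
theorem TruncPoly.algHom_eq {k B : Type*} [CommRing k] [Semiring B] [Algebra k B] {N : ℕ}
    {f g : TruncPoly k N →ₐ[k] B} (h : f (truncT k N) = g (truncT k N)) : f = g :=
  Ideal.Quotient.algHom_ext k (Polynomial.algHom_ext h)

/-- The endomorphism of `k[T]/(T^N)` sending the class of `T` to `d` times itself. -/
noncomputable def TruncPoly.scale {k : Type*} [CommRing k] (N : ℕ) (d : k) :
    TruncPoly k N →ₐ[k] TruncPoly k N :=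
  Ideal.Quotient.liftₐ _ (Polynomial.aeval (d • truncT k N)) fun x hx => by
    obtain ⟨y, rfl⟩ := Ideal.mem_span_singleton'.mp hx
    rw [map_mul, map_pow, Polynomial.aeval_X, smul_pow, truncT_pow_self, smul_zero, mul_zero]

theorem TruncPoly.scale_truncT {k : Type*} [CommRing k] (N : ℕ) (d : k) :
    TruncPoly.scale N d (truncT k N) = d • truncT k N :=
  Polynomial.aeval_X (d • truncT k N)

/-- An endomorphism of `k[T]/(T^N)` rescaling the class of `T` by a unit is bijective. -/
theorem TruncPoly.bijective_of_map_truncT {k : Type*} [CommRing k] {N : ℕ} {c : k}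
    (hc : IsUnit c) {φ : TruncPoly k N →ₐ[k] TruncPoly k N}
    (hφ : φ (truncT k N) = c • truncT k N) : Function.Bijective φ := by
  obtain ⟨u, rfl⟩ := hc
  have hl : (TruncPoly.scale N (↑u⁻¹ : k)).comp φ = AlgHom.id k _ := by
    apply TruncPoly.algHom_eq
    rw [AlgHom.comp_apply, hφ, map_smul, TruncPoly.scale_truncT, smul_smul, Units.mul_inv,
      one_smul, AlgHom.id_apply]
  have hr : φ.comp (TruncPoly.scale N (↑u⁻¹ : k)) = AlgHom.id k _ := by
    apply TruncPoly.algHom_eq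
    rw [AlgHom.comp_apply, TruncPoly.scale_truncT, map_smul, hφ, smul_smul, Units.inv_mul,
      one_smul, AlgHom.id_apply]
  exact Function.bijective_iff_has_inverse.mpr
    ⟨TruncPoly.scale N (↑u⁻¹ : k), DFunLike.congr_fun hl, DFunLike.congr_fun hr⟩

/-- Let `k` be a field of characteristic `p > 0`, `n ≥ 1`, `a, b ∈ k` and `c ∈ k` invertible
with `a = b·c^{p^{n-1}+p-1}`.  Let `A_{a,n}` (resp. `A_{b,n}`) be `k[T]/(T^{p^n})` with the
bialgebra structure `Δₐ` (resp. `Δᵦ`) in which `Δ(T̄) = T̄⊗1 + 1⊗T̄ + a • T̄^{p^{n-1}} ⊗ T̄^p`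
(resp. with `b`) and the counit `ε` sends `T̄` to `0`.  Then the `k`-algebra endomorphism `φ`
of `k[T]/(T^{p^n})` with `φ(T̄) = c·T̄` is a bialgebra isomorphism from `A_{b,n}` to
`A_{a,n}`. -/
theorem stmt_13 (k : Type*) [Field k] (p n : ℕ) (hp : p.Prime) (hchar : CharP k p)
    (hn : 1 ≤ n) (a b c : k) (hc : IsUnit c) (hab : a = b * c ^ (p ^ (n - 1) + p - 1))
    (Δa Δb : TruncPoly k (p ^ n) →ₐ[k] TruncPoly k (p ^ n) ⊗[k] TruncPoly k (p ^ n))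
    (ε : TruncPoly k (p ^ n) →ₐ[k] k)
    (hbia : IsBialgebraStructure k (TruncPoly k (p ^ n)) Δa ε)
    (hbib : IsBialgebraStructure k (TruncPoly k (p ^ n)) Δb ε)
    (hεT : ε (truncT k (p ^ n)) = 0)
    (hΔaT : Δa (truncT k (p ^ n)) =
      truncT k (p ^ n) ⊗ₜ[k] (1 : TruncPoly k (p ^ n)) +
        (1 : TruncPoly k (p ^ n)) ⊗ₜ[k] truncT k (p ^ n) +
        a • ((truncT k (p ^ n) ^ p ^ (n - 1)) ⊗ₜ[k] (truncT k (p ^ n) ^ p)))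
    (hΔbT : Δb (truncT k (p ^ n)) =
      truncT k (p ^ n) ⊗ₜ[k] (1 : TruncPoly k (p ^ n)) +
        (1 : TruncPoly k (p ^ n)) ⊗ₜ[k] truncT k (p ^ n) +
        b • ((truncT k (p ^ n) ^ p ^ (n - 1)) ⊗ₜ[k] (truncT k (p ^ n) ^ p)))
    (φ : TruncPoly k (p ^ n) →ₐ[k] TruncPoly k (p ^ n))
    (hφT : φ (truncT k (p ^ n)) = c • truncT k (p ^ n)) :
    Function.Bijective φ ∧
    (∀ x, Δa (φ x) = (Algebra.TensorProduct.map φ φ) (Δb x)) ∧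
    (∀ x, ε (φ x) = ε x) := by
  refine ⟨TruncPoly.bijective_of_map_truncT hc hφT, fun x => ?_, fun x => ?_⟩
  · have h : Δa.comp φ = (Algebra.TensorProduct.map φ φ).comp Δb := by
      apply TruncPoly.algHom_eq
      have hexp : c * a = b * (c ^ p * c ^ p ^ (n - 1)) := by
        have he : p ^ (n - 1) + p = (p ^ (n - 1) + p - 1) + 1 := by
          have := hp.pos
          omega
        rw [hab, ← pow_add, add_comm p, he, pow_succ, Nat.add_sub_cancel]
        ring
      rw [AlgHom.comp_apply, AlgHom.comp_apply, hφT, map_smul, hΔaT, hΔbT]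
      simp only [map_add, map_smul, Algebra.TensorProduct.map_tmul, map_pow, map_one, hφT,
        smul_pow, smul_add, smul_smul, hexp,
        ← TensorProduct.smul_tmul', TensorProduct.tmul_smul]
    exact DFunLike.congr_fun h x
  · have h : ε.comp φ = ε := by
      apply TruncPoly.algHom_eq
      rw [AlgHom.comp_apply, hφT, map_smul, hεT, smul_zero]
    exact DFunLike.congr_fun h x
end

section
/- Let k be a field of characteristic p > 0, let a, b ∈ k be nonzero, and let n be an integer with n > 2, or n = 2 and p = 2. Let A_{a,n} denote k[T]/(T^{p^n}) with the bialgebra structure in which Δ(T̄) = T̄⊗1 + 1⊗T̄ + a·T̄^{p^{n−1}}⊗T̄^{p} and the counit sends T̄ to 0, and similarly for A_{b,n}. Then A_{a,n} and A_{b,n} are isomorphic as k-bialgebras if and only if b/a is a (p^{n−1}+p−1)-th power in k. -/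
open scoped TensorProduct

/-- The algebra `A` is the truncated polynomial algebra of height `N` on the generator `t`, with
`c i` the functional reading off the coefficient of `t ^ i`. -/
structure IsTruncatedPolynomial {k A : Type*} [CommRing k] [CommRing A] [Algebra k A] (N : ℕ)
    (t : A) (c : ℕ → A →ₗ[k] k) : Prop where
  surjective_aeval : Function.Surjective (Polynomial.aeval (R := k) t)
  pow_eq_zero : t ^ N = 0
  coeff_aeval : ∀ i < N, ∀ f : Polynomial k, c i (Polynomial.aeval t f) = f.coeff i
  exists_algHom : ∀ s : A, s ^ N = 0 → ∃ φ : A →ₐ[k] A, φ t = s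

namespace IsTruncatedPolynomial

variable {k A : Type*} [CommRing k] [CommRing A] [Algebra k A] {N : ℕ} {t : A}
  {c : ℕ → A →ₗ[k] k}

theorem coeff_pow (ht : IsTruncatedPolynomial N t c) {i : ℕ} (hi : i < N) (u : ℕ) :
    c i (t ^ u) = if i = u then 1 else 0 := by
  have h := ht.coeff_aeval i hi (Polynomial.X ^ u)
  rwa [map_pow, Polynomial.aeval_X, Polynomial.coeff_X_pow] at h

theorem coeff_pow_mul (ht : IsTruncatedPolynomial N t c) {i u : ℕ} (hi : i < N) (hu : i < u)
    (x : A) : c i (t ^ u * x) = 0 := by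
  obtain ⟨f, rfl⟩ := ht.surjective_aeval x
  have h := ht.coeff_aeval i hi (Polynomial.X ^ u * f)
  rwa [map_mul, map_pow, Polynomial.aeval_X, Polynomial.coeff_X_pow_mul', if_neg hu.not_ge] at h

theorem algHom_ext (ht : IsTruncatedPolynomial N t c) {B : Type*} [CommRing B] [Algebra k B]
    {ψ χ : A →ₐ[k] B} (h : ψ t = χ t) : ψ = χ := by
  ext x
  obtain ⟨f, rfl⟩ := ht.surjective_aeval x
  rw [← Polynomial.aeval_algHom_apply, ← Polynomial.aeval_algHom_apply, h]

/-- The functional `x ⊗ y ↦ c i x * c j y`. -/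
noncomputable def biCoeff (c : ℕ → A →ₗ[k] k) (i j : ℕ) : A ⊗[k] A →ₗ[k] k :=
  LinearMap.mul' k k ∘ₗ TensorProduct.map (c i) (c j)

theorem biCoeff_tmul (c : ℕ → A →ₗ[k] k) (i j : ℕ) (x y : A) :
    biCoeff c i j (x ⊗ₜ[k] y) = c i x * c j y := by
  simp [biCoeff]

theorem biCoeff_pow_tmul_pow_mul_of_lt (ht : IsTruncatedPolynomial N t c) {i u : ℕ}
    (hi : i < N) (hu : i < u) (j v : ℕ) (w : A ⊗[k] A) :
    biCoeff c i j (((t ^ u) ⊗ₜ[k] (t ^ v)) * w) = 0 := by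
  induction w with
  | zero => rw [mul_zero, map_zero]
  | tmul x y =>
    rw [Algebra.TensorProduct.tmul_mul_tmul, biCoeff_tmul, ht.coeff_pow_mul hi hu, zero_mul]
  | add x y hx hy => rw [mul_add, map_add, hx, hy, add_zero]

theorem biCoeff_pow_tmul_pow_mul_add_pow (ht : IsTruncatedPolynomial N t c) {i j u v : ℕ}
    (hi : i < N) (hj : j < N) (hu : u ≤ i) (hv : v ≤ j) (m : ℕ) :
    biCoeff c i j (((t ^ u) ⊗ₜ[k] (t ^ v)) *
      (t ⊗ₜ[k] (1 : A) + (1 : A) ⊗ₜ[k] t) ^ m) =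
    if m + u + v = i + j then (m.choose (i - u) : k) else 0 := by
  have key : ∀ l, biCoeff c i j (((t ^ u) ⊗ₜ[k] (t ^ v)) *
      ((t ⊗ₜ[k] (1 : A)) ^ l * ((1 : A) ⊗ₜ[k] t) ^ (m - l) * (m.choose l : A ⊗[k] A))) =
      if l = i - u then (if v + (m - l) = j then (m.choose l : k) else 0) else 0 := by
    intro l
    rw [← nsmul_eq_mul', mul_smul_comm, map_nsmul]
    simp only [Algebra.TensorProduct.tmul_pow, one_pow, Algebra.TensorProduct.tmul_mul_tmul,
      one_mul, mul_one, ← pow_add, biCoeff_tmul, ht.coeff_pow hi, ht.coeff_pow hj]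
    have h1 : i = u + l ↔ l = i - u := by omega
    have h2 : j = v + (m - l) ↔ v + (m - l) = j := eq_comm
    simp only [h1, h2]
    split_ifs <;> simp
  rw [add_pow, Finset.mul_sum, map_sum, Finset.sum_congr rfl (fun l _ => key l),
    Finset.sum_ite_eq']
  by_cases hm : i - u ≤ m
  · rw [if_pos (Finset.mem_range.2 (by omega))]
    exact if_congr (by omega) rfl rfl
  · rw [if_neg (by simp only [Finset.mem_range]; omega), if_neg (by omega)]

theorem biCoeff_pow (ht : IsTruncatedPolynomial N t c) {i j q : ℕ} (hi : i < N) (hj : j < N)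
    (hiq : i < 2 * q) (r : ℕ) (a : k) (m : ℕ) :
    biCoeff c i j ((t ⊗ₜ[k] (1 : A) + (1 : A) ⊗ₜ[k] t +
        a • ((t ^ q) ⊗ₜ[k] (t ^ r))) ^ m) =
    (if m = i + j then (m.choose i : k) else 0) +
      m * a * biCoeff c i j (((t ^ q) ⊗ₜ[k] (t ^ r)) *
        (t ⊗ₜ[k] (1 : A) + (1 : A) ⊗ₜ[k] t) ^ (m - 1)) := by
  set S := t ⊗ₜ[k] (1 : A) + (1 : A) ⊗ₜ[k] t with hS
  set W := (t ^ q) ⊗ₜ[k] (t ^ r) with hW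
  obtain ⟨K, hK⟩ := Polynomial.powAddExpansion S (a • W) m
  have hW2 : W ^ 2 = (t ^ (2 * q)) ⊗ₜ[k] (t ^ (2 * r)) := by
    rw [hW, Algebra.TensorProduct.tmul_pow, ← pow_mul, ← pow_mul, mul_comm q, mul_comm r]
  have h0 : biCoeff c i j (S ^ m) = if m = i + j then (m.choose i : k) else 0 := by
    have h := ht.biCoeff_pow_tmul_pow_mul_add_pow hi hj (Nat.zero_le i) (Nat.zero_le j) m
    simpa only [pow_zero, ← Algebra.TensorProduct.one_def, one_mul, add_zero, Nat.sub_zero,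
      ← hS] using h
  have h1 : (m : A ⊗[k] A) * S ^ (m - 1) * (a • W) = ((m : k) * a) • (W * S ^ (m - 1)) := by
    rw [Algebra.smul_def, Algebra.smul_def, map_mul, map_natCast]
    ring
  have h2 : K * (a • W) ^ 2 = (a ^ 2) • (W ^ 2 * K) := by
    rw [Algebra.smul_def, Algebra.smul_def, map_pow]
    ring
  rw [hK, h1, h2, map_add, map_add, map_smul, map_smul, hW2,
    ht.biCoeff_pow_tmul_pow_mul_of_lt hi hiq, smul_zero, add_zero, h0, smul_eq_mul]

theorem biCoeff_aeval (ht : IsTruncatedPolynomial N t c) {q r : ℕ} (hq : q < N) (hr : r < N)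
    (hq0 : 0 < q) (a : k) (f : Polynomial k) :
    biCoeff c q r (Polynomial.aeval (t ⊗ₜ[k] (1 : A) + (1 : A) ⊗ₜ[k] t +
        a • ((t ^ q) ⊗ₜ[k] (t ^ r))) f) =
    ((q + r).choose q : k) * f.coeff (q + r) + a * f.coeff 1 := by
  induction f using Polynomial.induction_on' with
  | add f g hf hg => rw [map_add, map_add, hf, hg, Polynomial.coeff_add, Polynomial.coeff_add]; ring
  | monomial m d =>
    rw [Polynomial.aeval_monomial, ← Algebra.smul_def, map_smul,
      ht.biCoeff_pow hq hr (by omega), ht.biCoeff_pow_tmul_pow_mul_add_pow hq hr le_rfl le_rfl,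
      Polynomial.coeff_monomial, Polynomial.coeff_monomial, smul_eq_mul, Nat.sub_self,
      Nat.choose_zero_right, Nat.cast_one]
    rcases m with _ | _ | m
    · simp [show ¬ (0 = q + r) by omega]
    · by_cases h : 1 = q + r
      · simp [← h]; ring
      · simp [h]; ring
    · rw [if_neg (by omega : ¬ m + 1 + 1 - 1 + q + r = q + r),
        if_neg (by omega : ¬ m + 1 + 1 = 1)]
      by_cases h : m + 1 + 1 = q + r
      · rw [if_pos h, if_pos h, h]; ring
      · rw [if_neg h, if_neg h]; ring

theorem biCoeff_swap_aeval (ht : IsTruncatedPolynomial N t c) {q r : ℕ} (hq : q < N)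
    (hr : r < N) (hrq : r < q) (a : k) (f : Polynomial k) :
    biCoeff c r q (Polynomial.aeval (t ⊗ₜ[k] (1 : A) + (1 : A) ⊗ₜ[k] t +
        a • ((t ^ q) ⊗ₜ[k] (t ^ r))) f) =
    ((q + r).choose q : k) * f.coeff (q + r) := by
  induction f using Polynomial.induction_on' with
  | add f g hf hg => rw [map_add, map_add, hf, hg, Polynomial.coeff_add]; ring
  | monomial m d =>
    rw [Polynomial.aeval_monomial, ← Algebra.smul_def, map_smul,
      ht.biCoeff_pow hr hq (by omega), ht.biCoeff_pow_tmul_pow_mul_of_lt hr hrq,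
      Polynomial.coeff_monomial, smul_eq_mul, mul_zero, add_zero, add_comm r q]
    by_cases h : m = q + r
    · rw [if_pos h, if_pos h, h, Nat.choose_symm_add, mul_comm]
    · rw [if_neg h, if_neg h, mul_zero, mul_zero]

theorem exists_bijective_algHom (ht : IsTruncatedPolynomial N t c) {d e : k} (hde : d * e = 1) :
    ∃ φ : A →ₐ[k] A, Function.Bijective φ ∧ φ t = e • t := by
  obtain ⟨φ, hφ⟩ := ht.exists_algHom (e • t) (by rw [smul_pow, ht.pow_eq_zero, smul_zero])
  obtain ⟨ψ, hψ⟩ := ht.exists_algHom (d • t) (by rw [smul_pow, ht.pow_eq_zero, smul_zero])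
  have h1 : φ.comp ψ = AlgHom.id k _ := ht.algHom_ext (by
    rw [AlgHom.comp_apply, hψ, map_smul, hφ, smul_smul, hde, one_smul, AlgHom.id_apply])
  have h2 : ψ.comp φ = AlgHom.id k _ := ht.algHom_ext (by
    rw [AlgHom.comp_apply, hφ, map_smul, hψ, smul_smul, mul_comm, hde, one_smul,
      AlgHom.id_apply])
  exact ⟨φ, Function.bijective_iff_has_inverse.2
    ⟨ψ, fun x => DFunLike.congr_fun h2 x, fun x => DFunLike.congr_fun h1 x⟩, hφ⟩

theorem coeff_zero_ne_zero [Nontrivial k] (ht : IsTruncatedPolynomial N t c) (hN : 1 < N)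
    {φ : A →ₐ[k] A} (hφ : Function.Injective φ) {g : Polynomial k}
    (hg : φ t = Polynomial.aeval t (Polynomial.X * g)) : g.coeff 0 ≠ 0 := by
  intro h0
  obtain ⟨h, rfl⟩ := Polynomial.X_dvd_iff.2 h0
  have hz : φ (t ^ (N - 1)) = 0 := by
    obtain ⟨e, he⟩ : ∃ e, 2 * (N - 1) = N + e := ⟨N - 2, by omega⟩
    rw [map_pow, hg, map_mul, map_mul, Polynomial.aeval_X, ← mul_assoc, ← sq, mul_pow, ← pow_mul,
      he, pow_add, ht.pow_eq_zero, zero_mul, zero_mul]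
  have h1 := ht.coeff_pow (by omega : N - 1 < N) (N - 1)
  rw [(map_eq_zero_iff φ hφ).1 hz, map_zero, if_pos rfl] at h1
  exact zero_ne_one h1

/-- Comparison of the coefficients of `t^q ⊗ t^r` and `t^r ⊗ t^q` of the image of `t` under a
map compatible with two comultiplications. -/
theorem coeff_relation (ht : IsTruncatedPolynomial N t c) {q r : ℕ} (hq : q < N) (hr : r < N)
    (hr0 : 0 < r) (hrq : r ≤ q) (hchoose : r < q ∨ ((q + r).choose q : k) = 0) (a b : k)
    (g : Polynomial k)
    (h : Polynomial.aeval (t ⊗ₜ[k] (1 : A) + (1 : A) ⊗ₜ[k] t +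
          a • ((t ^ q) ⊗ₜ[k] (t ^ r))) (Polynomial.X * g) =
      Polynomial.aeval t (Polynomial.X * g) ⊗ₜ[k] (1 : A) +
        (1 : A) ⊗ₜ[k] Polynomial.aeval t (Polynomial.X * g) +
        b • ((Polynomial.aeval t (Polynomial.X * g) ^ q) ⊗ₜ[k]
          (Polynomial.aeval t (Polynomial.X * g) ^ r))) :
    a * g.coeff 0 = b * g.coeff 0 ^ (q + r) := by
  have hq0 : 0 < q := hr0.trans_le hrq
  have hone : ∀ i < N, 0 < i → c i (1 : A) = 0 := by
    intro i hi h0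
    have := ht.coeff_pow hi 0
    rwa [pow_zero, if_neg h0.ne'] at this
  have hself : ∀ i < N,
      c i (Polynomial.aeval t (Polynomial.X * g) ^ i) = g.coeff 0 ^ i := by
    intro i hi
    rw [← map_pow, ht.coeff_aeval i hi, mul_pow, Polynomial.coeff_X_pow_mul', if_pos le_rfl,
      Nat.sub_self, Polynomial.coeff_zero_eq_eval_zero, Polynomial.eval_pow,
      ← Polynomial.coeff_zero_eq_eval_zero]
  have hvanish : ((q + r).choose q : k) * (Polynomial.X * g).coeff (q + r) = 0 := by
    rcases hchoose with hlt | h0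
    · have h2 := congrArg (biCoeff c r q) h
      rw [ht.biCoeff_swap_aeval hq hr hlt, map_add, map_add, map_smul, biCoeff_tmul,
        biCoeff_tmul, biCoeff_tmul, hone _ hq hq0, hone _ hr hr0, map_mul, Polynomial.aeval_X,
        mul_pow, ht.coeff_pow_mul hr hlt] at h2
      simpa using h2
    · rw [h0, zero_mul]
  have h1 := congrArg (biCoeff c q r) h
  rw [ht.biCoeff_aeval hq hr hq0, hvanish, map_add, map_add, map_smul, biCoeff_tmul,
    biCoeff_tmul, biCoeff_tmul, hone _ hq hq0, hone _ hr hr0, hself _ hq, hself _ hr,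
    Polynomial.coeff_X_mul] at h1
  rw [pow_add]
  simpa using h1

theorem exists_bialgebra_iso_iff {k A : Type*} [Field k] [CommRing A] [Algebra k A] {N : ℕ}
    {t : A} {c : ℕ → A →ₗ[k] k} (ht : IsTruncatedPolynomial N t c) {q r : ℕ} (hq : q < N)
    (hr : r < N) (hr0 : 0 < r) (hrq : r ≤ q) (hchoose : r < q ∨ ((q + r).choose q : k) = 0)
    {a b : k} (ha : a ≠ 0) (hb : b ≠ 0) (Δa Δb : A →ₐ[k] A ⊗[k] A) (ε : A →ₐ[k] k)
    (hεt : ε t = 0)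
    (hΔa : Δa t = t ⊗ₜ[k] (1 : A) + (1 : A) ⊗ₜ[k] t + a • ((t ^ q) ⊗ₜ[k] (t ^ r)))
    (hΔb : Δb t = t ⊗ₜ[k] (1 : A) + (1 : A) ⊗ₜ[k] t + b • ((t ^ q) ⊗ₜ[k] (t ^ r))) :
    (∃ φ : A →ₐ[k] A, Function.Bijective φ ∧
        (∀ x, Δa (φ x) = (Algebra.TensorProduct.map φ φ) (Δb x)) ∧ (∀ x, ε (φ x) = ε x)) ↔
      ∃ d : k, b / a = d ^ (q + r - 1) := by
  have hexp : q + r - 1 + 1 = q + r := by omega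
  have hqr : q + r - 1 ≠ 0 := by omega
  constructor
  · rintro ⟨φ, hbij, hΔ, hε⟩
    obtain ⟨f, hf⟩ := ht.surjective_aeval (φ t)
    have hf0 : f.coeff 0 = 0 := by
      have h := hε t
      rw [hεt, ← hf, ← Polynomial.aeval_algHom_apply, hεt] at h
      simpa [Polynomial.coeff_zero_eq_aeval_zero] using h
    obtain ⟨g, rfl⟩ := Polynomial.X_dvd_iff.2 hf0
    have hg := ht.coeff_zero_ne_zero (by omega) hbij.1 hf.symm
    have h := hΔ t
    rw [← hf, ← Polynomial.aeval_algHom_apply, hΔa, hΔb, map_add, map_add, map_smul,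
      Algebra.TensorProduct.map_tmul, Algebra.TensorProduct.map_tmul,
      Algebra.TensorProduct.map_tmul, map_one, map_pow, map_pow, ← hf] at h
    have hrel := ht.coeff_relation hq hr hr0 hrq hchoose a b g h
    refine ⟨(g.coeff 0)⁻¹, ?_⟩
    rw [← hexp, pow_succ, ← mul_assoc] at hrel
    rw [mul_right_cancel₀ hg hrel, inv_pow]
    field_simp
  · rintro ⟨d, hd⟩
    have hd0 : d ≠ 0 := by
      rintro rfl
      rw [zero_pow hqr] at hd
      exact div_ne_zero hb ha hd
    obtain ⟨φ, hbij, hφ⟩ := ht.exists_bijective_algHom (mul_inv_cancel₀ hd0)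
    have hab : d⁻¹ * a = b * (d⁻¹ ^ q * d⁻¹ ^ r) := by
      have hb' : b = d ^ (q + r - 1) * a := by rw [← hd, div_mul_cancel₀ _ ha]
      rw [← pow_add, ← hexp, pow_succ, hb', inv_pow]
      field_simp
    have hΔ : Δa.comp φ = (Algebra.TensorProduct.map φ φ).comp Δb := ht.algHom_ext (by
      simp only [AlgHom.comp_apply, hφ, map_smul, hΔa, hΔb, map_add,
        Algebra.TensorProduct.map_tmul, map_one, map_pow, smul_pow, smul_add, smul_smul, hab,
        TensorProduct.smul_tmul', TensorProduct.tmul_smul]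
      rw [show b * (d⁻¹ ^ q * d⁻¹ ^ r) = d⁻¹ ^ r * (b * d⁻¹ ^ q) by ring])
    have hε : ε.comp φ = ε := ht.algHom_ext (by
      rw [AlgHom.comp_apply, hφ, map_smul, hεt, smul_zero])
    exact ⟨φ, hbij, fun x => DFunLike.congr_fun hΔ x, fun x => DFunLike.congr_fun hε x⟩

end IsTruncatedPolynomial

namespace TruncPoly

variable (k : Type*) [CommRing k] (N : ℕ)

/-- The coefficient of `T^i` of an element of `k[T]/(T^N)`, for `i < N`, and `0` for `N ≤ i`. -/
noncomputable def coeff (i : ℕ) : TruncPoly k N →ₗ[k] k :=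
  (((Ideal.span {(Polynomial.X : Polynomial k) ^ N}).restrictScalars k).liftQ
      (if i < N then Polynomial.lcoeff k i else 0) (by
        intro f hf
        obtain ⟨g, rfl⟩ := Ideal.mem_span_singleton.1 hf
        by_cases hi : i < N <;> simp [Polynomial.coeff_X_pow_mul', hi])) ∘ₗ
    (Submodule.Quotient.restrictScalarsEquiv k
      (Ideal.span {(Polynomial.X : Polynomial k) ^ N})).symm.toLinearMap

theorem coeff_mk {i : ℕ} (hi : i < N) (f : Polynomial k) :
    coeff k N i (Ideal.Quotient.mk _ f) = f.coeff i := by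
  change (if i < N then Polynomial.lcoeff k i else 0) f = f.coeff i
  rw [if_pos hi, Polynomial.lcoeff_apply]

theorem aeval_truncT (f : Polynomial k) :
    Polynomial.aeval (truncT k N) f = Ideal.Quotient.mk _ f := by
  have h := Polynomial.aeval_algHom_apply
    (Ideal.Quotient.mkₐ k (Ideal.span {(Polynomial.X : Polynomial k) ^ N})) Polynomial.X f
  rwa [Polynomial.aeval_X_left_apply] at h

theorem isTruncatedPolynomial : IsTruncatedPolynomial N (truncT k N) (coeff k N) where
  surjective_aeval x := by
    obtain ⟨f, rfl⟩ := Ideal.Quotient.mk_surjective x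
    exact ⟨f, aeval_truncT k N f⟩
  pow_eq_zero := by
    rw [← map_pow]
    exact Ideal.Quotient.eq_zero_iff_mem.2 (Ideal.mem_span_singleton_self _)
  coeff_aeval i hi f := by rw [aeval_truncT, coeff_mk k N hi]
  exists_algHom s hs := by
    refine ⟨Ideal.Quotient.liftₐ _ (Polynomial.aeval s) fun f hf => ?_, ?_⟩
    · obtain ⟨g, rfl⟩ := Ideal.mem_span_singleton.1 hf
      rw [map_mul, map_pow, Polynomial.aeval_X, hs, zero_mul]
    · exact Polynomial.aeval_X s

end TruncPoly

/-- Let `k` be a field of characteristic `p > 0`, `a, b ∈ k` nonzero, and `n > 2`, or `n = 2`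
and `p = 2`.  Let `A_{a,n}` (resp. `A_{b,n}`) be `k[T]/(T^{p^n})` with the bialgebra structure
`Δₐ` (resp. `Δᵦ`) in which `Δ(T̄) = T̄⊗1 + 1⊗T̄ + a • T̄^{p^{n-1}} ⊗ T̄^p` (resp. with `b`)
and the counit `ε` sends `T̄` to `0`.  Then `A_{a,n}` and `A_{b,n}` are isomorphic as
`k`-bialgebras if and only if `b/a` is a `(p^{n-1}+p-1)`-th power in `k`. -/
theorem stmt_14 (k : Type*) [Field k] (p n : ℕ) (hp : p.Prime) (hchar : CharP k p)
    (a b : k) (ha : a ≠ 0) (hb : b ≠ 0) (hn : 2 < n ∨ (n = 2 ∧ p = 2))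
    (Δa Δb : TruncPoly k (p ^ n) →ₐ[k] TruncPoly k (p ^ n) ⊗[k] TruncPoly k (p ^ n))
    (ε : TruncPoly k (p ^ n) →ₐ[k] k)
    (hbia : IsBialgebraStructure k (TruncPoly k (p ^ n)) Δa ε)
    (hbib : IsBialgebraStructure k (TruncPoly k (p ^ n)) Δb ε)
    (hεT : ε (truncT k (p ^ n)) = 0)
    (hΔaT : Δa (truncT k (p ^ n)) =
      truncT k (p ^ n) ⊗ₜ[k] (1 : TruncPoly k (p ^ n)) +
        (1 : TruncPoly k (p ^ n)) ⊗ₜ[k] truncT k (p ^ n) +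
        a • ((truncT k (p ^ n) ^ p ^ (n - 1)) ⊗ₜ[k] (truncT k (p ^ n) ^ p)))
    (hΔbT : Δb (truncT k (p ^ n)) =
      truncT k (p ^ n) ⊗ₜ[k] (1 : TruncPoly k (p ^ n)) +
        (1 : TruncPoly k (p ^ n)) ⊗ₜ[k] truncT k (p ^ n) +
        b • ((truncT k (p ^ n) ^ p ^ (n - 1)) ⊗ₜ[k] (truncT k (p ^ n) ^ p))) :
    (∃ φ : TruncPoly k (p ^ n) →ₐ[k] TruncPoly k (p ^ n),
        Function.Bijective φ ∧
        (∀ x, Δa (φ x) = (Algebra.TensorProduct.map φ φ) (Δb x)) ∧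
        (∀ x, ε (φ x) = ε x)) ↔
      ∃ c : k, b / a = c ^ (p ^ (n - 1) + p - 1) := by
  have hp2 : 2 ≤ p := hp.two_le
  have hn2 : 2 ≤ n := by omega
  have hpq : p ≤ p ^ (n - 1) := by
    simpa using Nat.pow_le_pow_right (by omega : 0 < p) (by omega : 1 ≤ n - 1)
  have hqN : p ^ (n - 1) < p ^ n := Nat.pow_lt_pow_right (by omega) (by omega)
  have hchoose : p < p ^ (n - 1) ∨ ((p ^ (n - 1) + p).choose (p ^ (n - 1)) : k) = 0 := by
    rcases hn with hn | ⟨rfl, rfl⟩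
    · left
      simpa using Nat.pow_lt_pow_right (by omega : 1 < p) (by omega : 1 < n - 1)
    · right
      have h6 : (2 ^ (2 - 1) + 2).choose (2 ^ (2 - 1)) = 2 * 3 := by decide
      rw [h6, Nat.cast_mul, CharP.cast_eq_zero, zero_mul]
  exact (TruncPoly.isTruncatedPolynomial k (p ^ n)).exists_bialgebra_iso_iff hqN
    (hpq.trans_lt hqN) (by omega) hpq hchoose ha hb Δa Δb ε hεT hΔaT hΔbT
end

section
/- Let k be a commutative ring of characteristic 2, and let R be the localization of the ring k[X, T, V][S]/(S²) at the multiplicative set generated by V and T + V·X. Then in R the element T + V·X + V²·S·X² is invertible, with inverse S + (T+V·X)^{-1} + T²·S·(T+V·X)^{-2}; that is, (T + V·X + V²·S·X²) · (S + (T+V·X)^{-1} + T²·S·(T+V·X)^{-2}) = 1. -/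
/-- The ring `k[X, T, V][S]/(S²)`, realized as `MvPolynomial (Fin 4) k` modulo `(X 3)²`,
with `X = X 0`, `T = X 1`, `V = X 2`, `S = X 3`. -/
abbrev SqZeroRing (k : Type*) [CommRing k] : Type _ :=
  MvPolynomial (Fin 4) k ⧸ Ideal.span {(MvPolynomial.X 3 : MvPolynomial (Fin 4) k) ^ 2}

/-- The class of `X` in `k[X,T,V][S]/(S²)`. -/
noncomputable abbrev szX (k : Type*) [CommRing k] : SqZeroRing k :=
  Ideal.Quotient.mk _ (MvPolynomial.X 0)

/-- The class of `T` in `k[X,T,V][S]/(S²)`. -/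
noncomputable abbrev szT (k : Type*) [CommRing k] : SqZeroRing k :=
  Ideal.Quotient.mk _ (MvPolynomial.X 1)

/-- The class of `V` in `k[X,T,V][S]/(S²)`. -/
noncomputable abbrev szV (k : Type*) [CommRing k] : SqZeroRing k :=
  Ideal.Quotient.mk _ (MvPolynomial.X 2)

/-- The class of `S` in `k[X,T,V][S]/(S²)`. -/
noncomputable abbrev szS (k : Type*) [CommRing k] : SqZeroRing k :=
  Ideal.Quotient.mk _ (MvPolynomial.X 3)

/-- The multiplicative set generated by `V` and `T + V·X`. -/
noncomputable abbrev szM (k : Type*) [CommRing k] : Submonoid (SqZeroRing k) :=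
  Submonoid.closure {szV k, szT k + szV k * szX k}

/-- Let `B → A` be a homomorphism of commutative rings, where `2 = 0` in `B`. If `s² = 0` and
`t + v x` becomes invertible in `A`, then so does `t + v x + v² s x²`, with inverse
`s + (t + v x)⁻¹ + t² s (t + v x)⁻²`. -/
theorem isUnit_and_mul_eq_one_of_sq_eq_zero {A B : Type*} [CommRing A] [CommRing B] (f : B →+* A)
    {x t v s : B} (h2 : (2 : B) = 0) (hs : s ^ 2 = 0) (hu : IsUnit (f (t + v * x))) :
    IsUnit (f (t + v * x + v ^ 2 * s * x ^ 2)) ∧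
      f (t + v * x + v ^ 2 * s * x ^ 2) *
        (f s + Ring.inverse (f (t + v * x)) +
          f (t ^ 2 * s) * Ring.inverse (f (t + v * x)) ^ 2) = 1 := by
  have hb := Ring.mul_inverse_cancel _ hu
  have hA2 : (2 : A) = 0 := by simpa only [map_ofNat, map_zero] using congrArg f h2
  have hAs : f s ^ 2 = 0 := by rw [← map_pow, hs, map_zero]
  generalize Ring.inverse (f (t + v * x)) = b at hb ⊢
  simp only [map_add, map_mul, map_pow] at hb ⊢
  have h : (f t + f v * f x + f v ^ 2 * f s * f x ^ 2) * (f s + b + f t ^ 2 * f s * b ^ 2) = 1 := by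
    linear_combination
      (1 + f t ^ 2 * f s * b - (f t + f v * f x) * f s) * hb +
        f v ^ 2 * f x ^ 2 * (1 + f t ^ 2 * b ^ 2) * hAs +
        f s * b * (f t ^ 2 + f v ^ 2 * f x ^ 2 + f t * f v * f x) * hA2
  exact ⟨.of_mul_eq_one _ h, h⟩

/-- Let `k` be a commutative ring of characteristic `2` and let `R` be the localization of
`k[X,T,V][S]/(S²)` at the multiplicative set generated by `V` and `T + V·X`.  Then
`T + V·X + V²·S·X²` is invertible in `R`, with inverse
`S + (T+V·X)⁻¹ + T²·S·(T+V·X)⁻²`. -/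
theorem stmt_17 (k : Type*) [CommRing k] (hchar : CharP k 2) :
    IsUnit (algebraMap (SqZeroRing k) (Localization (szM k))
        (szT k + szV k * szX k + szV k ^ 2 * szS k * szX k ^ 2)) ∧
    algebraMap (SqZeroRing k) (Localization (szM k))
        (szT k + szV k * szX k + szV k ^ 2 * szS k * szX k ^ 2) *
      (algebraMap (SqZeroRing k) (Localization (szM k)) (szS k) +
        Ring.inverse (algebraMap (SqZeroRing k) (Localization (szM k))
          (szT k + szV k * szX k)) +
        algebraMap (SqZeroRing k) (Localization (szM k)) (szT k ^ 2 * szS k) *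
          Ring.inverse (algebraMap (SqZeroRing k) (Localization (szM k))
            (szT k + szV k * szX k)) ^ 2) = 1 := by
  have h2 : (2 : SqZeroRing k) = 0 := by
    have h : (2 : k) = 0 := CharTwo.two_eq_zero
    simpa only [map_ofNat, map_zero] using congrArg (algebraMap k (SqZeroRing k)) h
  have hs : szS k ^ 2 = 0 := by
    rw [← map_pow]
    exact Ideal.Quotient.eq_zero_iff_mem.mpr (Ideal.mem_span_singleton_self _)
  have hu : IsUnit (algebraMap (SqZeroRing k) (Localization (szM k)) (szT k + szV k * szX k)) :=
    IsLocalization.map_units (Localization (szM k))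
      (⟨szT k + szV k * szX k, Submonoid.subset_closure (by simp)⟩ : szM k)
  exact isUnit_and_mul_eq_one_of_sq_eq_zero (A := Localization (szM k)) (B := SqZeroRing k)
    (algebraMap (SqZeroRing k) (Localization (szM k)))
    (x := szX k) (t := szT k) (v := szV k) (s := szS k) h2 hs hu
end
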